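/- arXiv:1906.06976 — 4 statements merged into one kernel-verified Lean document; each statement's English description precedes it below -/
import Mathlib

section
/- Let d ≥ 1, let Λ ⊂ ℤ^d be a finite cube centered at the origin, let λ > 0 and E, Ẽ ∈ ℝ. Let {V_j}_{j∈Λ} be i.i.d. standard Cauchy random variables and H_Λ = −Δ + λV. Then the limit as ε → 0⁺ of the generating function 𝒢_ε(E,Ẽ) = E[ det((E+iε)·1_Λ − H_Λ) / det((Ẽ+iε)·1_Λ − H_Λ) ] exists and equals det((E+iλ)·1_Λ − H₀) / det((Ẽ+iλ)·1_Λ − H₀), where H₀ = −Δ. -/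
open MeasureTheory Matrix Filter

noncomputable section

/-- ℓ¹ distance on ℤ^d. -/
def dist1 {d : ℕ} (x y : Fin d → ℤ) : ℤ := ∑ i, |x i - y i|

/-- The cube [-L, L]^d in ℤ^d, centered at the origin. -/
def cube (d L : ℕ) : Finset (Fin d → ℤ) :=
  Finset.Icc (fun _ => -(L : ℤ)) (fun _ => (L : ℤ))

/-- Entries of the discrete Laplacian associated to a finite volume Λ:
`(Δψ)(j) = ∑_{k ∈ Λ, |j-k|₁ = 1} (ψ(k) - ψ(j))`. -/
def lapE {d : ℕ} (Λ : Finset (Fin d → ℤ)) (j k : Fin d → ℤ) : ℂ :=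
  (if dist1 j k = 1 then 1 else 0) -
    (if j = k then ((Λ.filter (fun k' => dist1 j k' = 1)).card : ℂ) else 0)

/-- The discrete Laplacian as a matrix on Λ. -/
def lap {d : ℕ} (Λ : Finset (Fin d → ℤ)) : Matrix Λ Λ ℂ :=
  fun j k => lapE Λ (j : Fin d → ℤ) (k : Fin d → ℤ)

/-- The standard Cauchy probability measure π⁻¹(1+x²)⁻¹ dx on ℝ. -/
def cauchy : Measure ℝ :=
  volume.withDensity (fun x => ENNReal.ofReal (1 / (Real.pi * (1 + x ^ 2))))


lemma cauchy_dens_meas : Measurable (fun x : ℝ => ENNReal.ofReal (1 / (Real.pi * (1 + x ^ 2)))) := by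
  fun_prop

instance cauchy_isProb : IsProbabilityMeasure cauchy := by
  constructor
  unfold cauchy
  rw [withDensity_apply _ MeasurableSet.univ, Measure.restrict_univ,
    ← ofReal_integral_eq_lintegral_ofReal]
  · have : ∀ x : ℝ, 1 / (Real.pi * (1 + x ^ 2)) = Real.pi⁻¹ * (1 + x ^ 2)⁻¹ := by
      intro x; rw [one_div, mul_inv]
    simp_rw [this, integral_const_mul, integral_univ_inv_one_add_sq]
    simp [Real.pi_ne_zero]
  · have : ∀ x : ℝ, 1 / (Real.pi * (1 + x ^ 2)) = Real.pi⁻¹ * (1 + x ^ 2)⁻¹ := by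
      intro x; rw [one_div, mul_inv]
    simp_rw [this]
    exact integrable_inv_one_add_sq.const_mul _
  · exact Filter.Eventually.of_forall fun x => by positivity

lemma sub_ne_of_im {w : ℂ} (hw : 0 < w.im) (x : ℝ) : (x : ℂ) - w ≠ 0 := by
  intro h
  have := congrArg Complex.im h
  simp at this
  linarith

lemma int_aux_integrable {w : ℂ} (hw : 0 < w.im) :
    Integrable (fun x : ℝ => 1 / (((x : ℂ) - Complex.I) * ((x : ℂ) - w))) := by
  have hI : (0 : ℝ) < Complex.I.im := by simp
  have h1 : Integrable (fun x : ℝ => (((1 + x ^ 2)⁻¹ : ℝ) : ℂ)) :=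
    integrable_inv_one_add_sq.ofReal
  have h2 : ∀ x : ℝ, ‖(1 : ℂ) + (Complex.I + w) / ((x : ℂ) - w)‖ ≤
      1 + ‖Complex.I + w‖ / w.im := by
    intro x
    refine (norm_add_le _ _).trans ?_
    rw [norm_one, norm_div]
    gcongr
    have := Complex.abs_im_le_norm ((x : ℂ) - w)
    simp only [Complex.sub_im, Complex.ofReal_im, zero_sub, abs_neg] at this
    exact (le_abs_self _).trans this
  have hcont : Continuous (fun x : ℝ => (1 : ℂ) + (Complex.I + w) / ((x : ℂ) - w)) := by
    refine continuous_const.add (continuous_const.div (by fun_prop) (sub_ne_of_im hw))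
  refine (h1.mul_bdd (c := 1 + ‖Complex.I + w‖ / w.im) hcont.aestronglyMeasurable
    (Filter.Eventually.of_forall h2)).congr (Filter.Eventually.of_forall fun x => ?_)
  have a1 := sub_ne_of_im hw x
  have a2 := sub_ne_of_im hI x
  have a3 : (1 + (x : ℂ) ^ 2) ≠ 0 := by
    have : (1 + x ^ 2 : ℝ) ≠ 0 := by positivity
    exact_mod_cast this
  have a4 : (1 + (x : ℂ) ^ 2) = (x - Complex.I) * (x + Complex.I) := by
    ring_nf; simp; ring
  simp only
  push_cast
  rw [inv_mul_eq_div, div_eq_div_iff a3 (mul_ne_zero a2 a1), a4]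
  field_simp
  ring

lemma tendsto_inv_sub (w : ℂ) (l : Filter ℝ) (hl : Tendsto (fun x : ℝ => ‖x‖) l atTop) :
    Tendsto (fun x : ℝ => 1 / ((x : ℂ) - w)) l (nhds 0) := by
  simp only [one_div]
  refine tendsto_inv₀_cobounded.comp ?_
  rw [← tendsto_norm_atTop_iff_cobounded]
  refine tendsto_atTop_mono (fun x => ?_) (tendsto_atTop_add_const_right _ (-‖w‖) hl)
  have := norm_sub_norm_le (x : ℂ) w
  simp at this ⊢
  linarith

lemma int_aux {w : ℂ} (hw : 0 < w.im) :
    ∫ x : ℝ, 1 / (((x : ℂ) - Complex.I) * ((x : ℂ) - w)) = 0 := by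
  have hI : (0 : ℝ) < Complex.I.im := by simp
  have top : Tendsto (fun x : ℝ => ‖x‖) atTop atTop := tendsto_norm_atTop_atTop
  have bot : Tendsto (fun x : ℝ => ‖x‖) atBot atTop := tendsto_abs_atBot_atTop
  by_cases h : w = Complex.I
  · subst h
    have hd : ∀ x : ℝ, HasDerivAt (fun x : ℝ => -(1 / ((x : ℂ) - Complex.I)))
        (1 / (((x : ℂ) - Complex.I) * ((x : ℂ) - Complex.I))) x := by
      intro x
      have a2 := sub_ne_of_im hI x
      have := (((Complex.ofRealCLM.hasDerivAt (x := x)).sub_const Complex.I).inv a2).neg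
      convert! this using 1
      · ext; simp
      · simp; field_simp
    have := integral_of_hasDerivAt_of_tendsto hd (int_aux_integrable hw)
      (tendsto_inv_sub _ _ bot).neg (tendsto_inv_sub _ _ top).neg
    simpa using this
  · have hne : w - Complex.I ≠ 0 := sub_ne_zero.mpr h
    have hd : ∀ x : ℝ, HasDerivAt
        (fun x : ℝ => (1 / (w - Complex.I)) *
          Complex.log (((x : ℂ) - w) * (1 / ((x : ℂ) - Complex.I))))
        (1 / (((x : ℂ) - Complex.I) * ((x : ℂ) - w))) x := by
      intro x
      have a1 := sub_ne_of_im hw x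
      have a2 := sub_ne_of_im hI x
      have d1 := (Complex.ofRealCLM.hasDerivAt (x := x)).sub_const w
      have d2 := (((Complex.ofRealCLM.hasDerivAt (x := x)).sub_const Complex.I).inv a2)
      have hs : ((x : ℂ) - w) * ((x : ℂ) - Complex.I)⁻¹ ∈ Complex.slitPlane := by
        rw [Complex.mem_slitPlane_iff_not_le_zero]
        intro hle
        rw [Complex.le_def] at hle
        set t := ((x : ℂ) - w) * ((x : ℂ) - Complex.I)⁻¹ with ht
        have e : (x : ℂ) - w = t * ((x : ℂ) - Complex.I) := by
          rw [ht]; field_simp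
        have e' := congrArg Complex.im e
        simp [hle.2] at e'
        have h0 := hle.1
        simp at h0
        have h00 : t.im = 0 := by simpa using hle.2


        linarith
      have := ((d1.mul d2).clog_real hs).const_mul (1 / (w - Complex.I))
      convert! this using 1
      · ext; simp
      · simp
        field_simp
        ring
    have lim : ∀ l : Filter ℝ, Tendsto (fun x : ℝ => ‖x‖) l atTop → Tendsto
        (fun x : ℝ => (1 / (w - Complex.I)) *
          Complex.log (((x : ℂ) - w) * (1 / ((x : ℂ) - Complex.I)))) l (nhds 0) := by
      intro l hl
      have e : (fun x : ℝ => ((x : ℂ) - w) * (1 / ((x : ℂ) - Complex.I))) =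
          fun x : ℝ => 1 + (Complex.I - w) * (1 / ((x : ℂ) - Complex.I)) := by
        ext x
        have a2 := sub_ne_of_im hI x
        field_simp
        ring
      have h1 : Tendsto (fun x : ℝ => ((x : ℂ) - w) * (1 / ((x : ℂ) - Complex.I))) l (nhds 1) := by
        rw [e]
        simpa using ((tendsto_inv_sub Complex.I l hl).const_mul (Complex.I - w)).const_add 1
      have h2 := (h1.clog (by simp)).const_mul (1 / (w - Complex.I))
      simpa using h2
    have := integral_of_hasDerivAt_of_tendsto hd (int_aux_integrable hw)
      (lim _ bot) (lim _ top)
    simpa using this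

lemma cauchy_mobius (α β γ δ : ℂ) (hne : ∀ w : ℂ, w.im ≤ 0 → γ * w + δ ≠ 0) (C : ℝ)
    (hC : ∀ x : ℝ, ‖(α * x + β) / (γ * x + δ)‖ ≤ C) :
    ∫ x : ℝ, (α * x + β) / (γ * x + δ) ∂cauchy =
      (α * (-Complex.I) + β) / (γ * (-Complex.I) + δ) := by
  by_cases hγ : γ = 0
  · subst hγ
    have hδ : δ ≠ 0 := by simpa using hne 0 (by simp)
    have hα : α = 0 := by
      by_contra hα
      have hα' : 0 < ‖α‖ := norm_pos_iff.mpr hα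
      have hδ' : 0 < ‖δ‖ := norm_pos_iff.mpr hδ
      have := hC ((C * ‖δ‖ + ‖β‖ + 1) / ‖α‖)
      have hC0 : 0 ≤ C := (norm_nonneg _).trans this
      rw [zero_mul, zero_add, norm_div, div_le_iff₀ hδ'] at this
      have h2 := norm_sub_le_norm_add (α * (((C * ‖δ‖ + ‖β‖ + 1) / ‖α‖ : ℝ) : ℂ)) β
      rw [norm_mul, Complex.norm_real, Real.norm_of_nonneg (by positivity),
        mul_div_cancel₀ _ hα'.ne'] at h2
      linarith
    subst hα
    simp
  · set w := -δ / γ with hwd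
    have hw : 0 < w.im := by
      by_contra hcon
      push Not at hcon
      refine hne w hcon ?_
      rw [hwd]; field_simp; simp
    have hne' : ∀ x : ℝ, γ * x + δ ≠ 0 := fun x => hne x (by simp)
    have hd0 : γ * (-Complex.I) + δ ≠ 0 := hne _ (by simp)
    set c := (α * (-Complex.I) + β) / (γ * (-Complex.I) + δ) with hc
    have hcont : Continuous (fun x : ℝ => (α * x + β) / (γ * x + δ)) :=
      Continuous.div (by fun_prop) (by fun_prop) hne'
    have hint : Integrable (fun x : ℝ => (α * x + β) / (γ * x + δ)) cauchy :=
      Integrable.of_bound hcont.aestronglyMeasurable C (Filter.Eventually.of_forall hC)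
    have key : ∫ x : ℝ, ((α * x + β) / (γ * x + δ) - c) ∂cauchy = 0 := by
      unfold cauchy
      rw [integral_withDensity_eq_integral_toReal_smul cauchy_dens_meas
        (Filter.Eventually.of_forall fun x => ENNReal.ofReal_lt_top)]
      have : ∀ x : ℝ, (ENNReal.ofReal (1 / (Real.pi * (1 + x ^ 2)))).toReal •
          ((α * x + β) / (γ * x + δ) - c) =
          ((α * δ - β * γ) / (Real.pi * γ * (γ * (-Complex.I) + δ))) *
            (1 / (((x : ℂ) - Complex.I) * ((x : ℂ) - w))) := by
        intro x
        rw [ENNReal.toReal_ofReal (by positivity), Complex.real_smul]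
        have hx := hne' x
        have a1 := sub_ne_of_im hw x
        have a2 : (x : ℂ) - Complex.I ≠ 0 := sub_ne_of_im (by simp) x
        have a3 : (1 + (x : ℂ) ^ 2) ≠ 0 := by
          have : (1 + x ^ 2 : ℝ) ≠ 0 := by positivity
          exact_mod_cast this
        have a4 : (1 + (x : ℂ) ^ 2) = (x - Complex.I) * (x + Complex.I) := by
          ring_nf; simp; ring
        have a5 : (x : ℂ) + Complex.I ≠ 0 := by
          intro h; rw [h, mul_zero] at a4; exact a3 a4
        have hpi : (Real.pi : ℂ) ≠ 0 := by exact_mod_cast Real.pi_ne_zero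
        have e1 : (x : ℂ) - w = (γ * x + δ) / γ := by rw [hwd]; field_simp; ring
        have e2 : (α * x + β) / (γ * x + δ) - c =
            (α * δ - β * γ) * (x + Complex.I) / ((γ * x + δ) * (γ * (-Complex.I) + δ)) := by
          rw [hc, div_sub_div _ _ hx hd0]
          congr 1
          ring
        rw [e1, e2]
        push_cast
        rw [a4]
        generalize γ * (-Complex.I) + δ = D at *
        generalize γ * (x : ℂ) + δ = D' at *
        field_simp
      simp_rw [this]
      rw [integral_const_mul, int_aux hw, mul_zero]
    rw [integral_sub hint (integrable_const _)] at key
    simp at key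
    exact sub_eq_zero.mp key

lemma fin_avg (n : ℕ) (f : (Fin n → ℂ) → ℂ) (hm : Measurable f) (C : ℝ)
    (hb : ∀ w, (∀ j, (w j).im ≤ 0) → ‖f w‖ ≤ C)
    (h1 : ∀ w j, (∀ j, (w j).im ≤ 0) →
      ∫ x : ℝ, f (Function.update w j x) ∂cauchy = f (Function.update w j (-Complex.I))) :
    ∫ V : Fin n → ℝ, f (fun j => (V j : ℂ)) ∂(Measure.pi fun _ => cauchy) =
      f (fun _ => -Complex.I) := by
  induction n with
  | zero =>
    have : ∀ V : Fin 0 → ℝ, (fun j => (V j : ℂ)) = fun _ => -Complex.I :=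
      fun V => Subsingleton.elim _ _
    simp_rw [this]
    simp
  | succ n ih =>
    have mp := (measurePreserving_piFinSuccAbove (fun _ : Fin (n + 1) => cauchy) 0).symm
    rw [← mp.integral_comp (MeasurableEquiv.measurableEmbedding _)]
    have e : ∀ p : ℝ × (Fin n → ℝ),
        (fun j => (((MeasurableEquiv.piFinSuccAbove (fun _ : Fin (n + 1) => ℝ) 0).symm p j : ℝ) : ℂ))
          = Fin.cons (p.1 : ℂ) (fun j => (p.2 j : ℂ)) := by
      intro p
      ext j
      refine Fin.cases ?_ (fun i => ?_) j <;>
        simp [MeasurableEquiv.piFinSuccAbove]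
    simp_rw [e]
    have hmc : Measurable (fun p : ℂ × (Fin n → ℂ) => (Fin.cons p.1 p.2 : Fin (n + 1) → ℂ)) := by
      refine measurable_pi_iff.mpr fun j => ?_
      refine Fin.cases ?_ (fun i => ?_) j
      · simpa using! measurable_fst
      · simpa using! (measurable_pi_apply i).comp measurable_snd
    have him : ∀ (z : ℂ) (v : Fin n → ℂ), z.im ≤ 0 → (∀ j, (v j).im ≤ 0) →
        ∀ j, ((Fin.cons z v : Fin (n + 1) → ℂ) j).im ≤ 0 := by
      intro z v hz hv j
      refine Fin.cases ?_ (fun i => ?_) j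
      · simpa using hz
      · simpa using hv i
    have hint : Integrable (fun p : ℝ × (Fin n → ℝ) =>
        f (Fin.cons (p.1 : ℂ) (fun j => (p.2 j : ℂ))))
        (cauchy.prod (Measure.pi fun _ => cauchy)) := by
      refine Integrable.of_bound (Measurable.aestronglyMeasurable ?_) C
        (Filter.Eventually.of_forall fun p => hb _ (him _ _ (by simp) (by simp)))
      refine hm.comp (hmc.comp (f := fun p : ℝ × (Fin n → ℝ) =>
        ((p.1 : ℂ), (fun j => (p.2 j : ℂ)))) (by fun_prop))
    have := integral_prod_symm _ hint
    refine this.trans ?_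
    have step : ∀ V : Fin n → ℝ, ∫ x : ℝ, f (Fin.cons (x : ℂ) (fun j => (V j : ℂ))) ∂cauchy =
        f (Fin.cons (-Complex.I) (fun j => (V j : ℂ))) := by
      intro V
      have := h1 (Fin.cons 0 (fun j => (V j : ℂ))) 0 (him _ _ (by simp) (by simp))
      simpa [Fin.update_cons_zero] using this
    simp only [step]
    have := ih (fun v => f (Fin.cons (-Complex.I) v))
      (hm.comp (hmc.comp (f := fun v : Fin n → ℂ => (-Complex.I, v)) (by fun_prop)))
      (fun w hw => hb _ (him _ _ (by simp) hw)) (fun w j hw => by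
        have := h1 (Fin.cons (-Complex.I) w) j.succ (him _ _ (by simp) hw)
        simpa [Fin.cons_update] using this)
    refine this.trans ?_
    congr 1
    ext j
    refine Fin.cases ?_ (fun i => ?_) j <;> simp

lemma pi_avg {ι : Type*} [Fintype ι] [DecidableEq ι] (f : (ι → ℂ) → ℂ) (hm : Measurable f) (C : ℝ)
    (hb : ∀ w, (∀ j, (w j).im ≤ 0) → ‖f w‖ ≤ C)
    (h1 : ∀ w j, (∀ j, (w j).im ≤ 0) →
      ∫ x : ℝ, f (Function.update w j x) ∂cauchy = f (Function.update w j (-Complex.I))) :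
    ∫ V : ι → ℝ, f (fun j => (V j : ℂ)) ∂(Measure.pi fun _ => cauchy) =
      f (fun _ => -Complex.I) := by
  let e := (Fintype.equivFin ι)
  have mp := measurePreserving_piCongrLeft (fun _ : ι => cauchy) e.symm
  rw [← mp.integral_comp (MeasurableEquiv.measurableEmbedding _)]
  have := fin_avg _ (fun w => f (fun i => w (e i))) (hm.comp (by fun_prop)) C
    (fun w hw => hb _ (fun j => hw _)) (fun w j hw => by
      have := h1 (fun i => w (e i)) (e.symm j) (fun j => hw _)
      have h2 : ∀ z, (fun i => Function.update w j z (e i)) =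
          Function.update (fun i => w (e i)) (e.symm j) z := by
        intro z; ext i
        by_cases h : i = e.symm j
        · subst h; simp
        · rw [Function.update_of_ne h, Function.update_of_ne]
          intro h'; exact h (by rw [← h']; simp)
      simpa only [h2] using this)
  refine Eq.trans ?_ this
  congr 1
  ext V
  congr 1
  ext i
  have := MeasurableEquiv.piCongrLeft_apply_apply (β := fun _ : ι => ℝ) e.symm V (e i)
  rw [Equiv.symm_apply_apply] at this
  rw [this]

/-- The resolvent matrix `z - (-K + lam w)` with complex potential `w`. -/
def resM {ι : Type*} [Fintype ι] [DecidableEq ι] (K : Matrix ι ι ℂ) (lam : ℝ) (z : ℂ)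
    (w : ι → ℂ) : Matrix ι ι ℂ :=
  (z • (1 : Matrix ι ι ℂ)) - (-K + Matrix.diagonal (fun j => (lam : ℂ) * w j))

section
variable {ι : Type*} [Fintype ι] [DecidableEq ι] (K : Matrix ι ι ℂ) (lam : ℝ)

lemma resM_affine (z : ℂ) (w : ι → ℂ) (j : ι) :
    ∃ α β : ℂ, ∀ t, (resM K lam z (Function.update w j t)).det = α * t + β := by
  let N := resM K lam z (Function.update w j 0)
  refine ⟨(N.updateRow j (Pi.single j (-(lam : ℂ)))).det, N.det, fun t => ?_⟩
  have : resM K lam z (Function.update w j t) =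
      N.updateRow j (t • Pi.single j (-(lam : ℂ)) + N j) := by
    ext a b
    by_cases ha : a = j
    · subst ha
      by_cases hb : b = a
      · subst hb
        simp [N, resM]; ring
      · simp [N, resM, hb, Matrix.diagonal_apply_ne _ (Ne.symm hb)]
    · rw [Matrix.updateRow_ne ha]
      by_cases hb : a = b
      · subst hb; simp [N, resM, ha]
      · simp [N, resM, Matrix.diagonal_apply_ne _ hb]
  rw [this, Matrix.det_updateRow_add, Matrix.det_updateRow_smul, Matrix.updateRow_eq_self]
  ring

lemma resM_im (hK : K.IsHermitian) (hlam : 0 ≤ lam) (z : ℂ) (e : ℝ) (w : ι → ℂ)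
    (hw : ∀ j, e ≤ z.im - lam * (w j).im) (y : ι → ℂ) :
    e * ∑ j, ‖y j‖ ^ 2 ≤ (star y ⬝ᵥ (resM K lam z w *ᵥ y)).im := by
  have h0 : (star y ⬝ᵥ K *ᵥ y).im = 0 := hK.im_star_dotProduct_mulVec_self y
  have e1 : resM K lam z w = Matrix.diagonal (fun j => z - lam * w j) + K := by
    ext a b
    by_cases hb : a = b
    · subst hb; simp [resM]; ring
    · simp [resM, hb]
  rw [e1, Matrix.add_mulVec, dotProduct_add, Complex.add_im, h0, add_zero]
  simp only [dotProduct, Matrix.mulVec_diagonal, Complex.im_sum, Finset.mul_sum]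
  refine Finset.sum_le_sum fun j _ => ?_
  have : star y j * ((z - lam * w j) * y j) = (z - lam * w j) * ((‖y j‖ ^ 2 : ℝ) : ℂ) := by
    have := Complex.conj_mul' (y j)
    simp only [Pi.star_apply, RCLike.star_def]
    push_cast
    rw [← this]; ring
  rw [this, Complex.im_mul_ofReal]
  have h := hw j
  have : (z - lam * w j).im = z.im - lam * (w j).im := by simp
  rw [this]
  gcongr

lemma resM_det_ne (hK : K.IsHermitian) (hlam : 0 ≤ lam) (z : ℂ) (e : ℝ) (he : 0 < e) (w : ι → ℂ)
    (hw : ∀ j, e ≤ z.im - lam * (w j).im) : (resM K lam z w).det ≠ 0 := by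
  intro hdet
  obtain ⟨y, hy, h⟩ := Matrix.exists_mulVec_eq_zero_iff.mpr hdet
  have := resM_im K lam hK hlam z e w hw y
  rw [h] at this
  simp at this
  apply hy
  ext j
  have hs : ∑ j, ‖y j‖ ^ 2 ≤ 0 := by
    by_contra hc
    push Not at hc
    have := mul_pos he hc
    linarith
  have h2 := Finset.single_le_sum (f := fun j => ‖y j‖ ^ 2) (fun i _ => by positivity)
    (Finset.mem_univ j)
  have h3 : ‖y j‖ ^ 2 = 0 := le_antisymm (h2.trans hs) (by positivity)
  simpa using h3

lemma resM_inv_le (hK : K.IsHermitian) (hlam : 0 ≤ lam) (z : ℂ) (e : ℝ) (he : 0 < e) (w : ι → ℂ)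
    (hw : ∀ j, e ≤ z.im - lam * (w j).im) (a b : ι) : ‖(resM K lam z w)⁻¹ a b‖ ≤ 1 / e := by
  have hdet := resM_det_ne K lam hK hlam z e he w hw
  set M := resM K lam z w with hM
  let y : ι → ℂ := fun a => M⁻¹ a b
  have hy : M *ᵥ y = Pi.single b 1 := by
    have h1 : M * M⁻¹ = 1 := Matrix.mul_nonsing_inv M (isUnit_iff_ne_zero.mpr hdet)
    ext c
    have := congrFun (congrFun h1 c) b
    rw [Matrix.mul_apply] at this
    simp only [Matrix.mulVec, dotProduct, y]
    rw [this, Matrix.one_apply, Pi.single_apply]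
  have h := resM_im K lam hK hlam z e w hw y
  rw [← hM, hy] at h
  have h' : e * ∑ j, ‖y j‖ ^ 2 ≤ ‖y b‖ := by
    refine h.trans ?_
    simp only [dotProduct_single, mul_one]
    refine (le_abs_self _).trans ((Complex.abs_im_le_norm _).trans ?_)
    simp
  have hle : ∀ j, e * ‖y j‖ ^ 2 ≤ ‖y b‖ := fun j => by
    refine le_trans ?_ h'
    gcongr
    exact Finset.single_le_sum (f := fun j => ‖y j‖ ^ 2) (fun i _ => by positivity)
      (Finset.mem_univ j)
  have hb : ‖y b‖ ≤ 1 / e := by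
    rw [le_div_iff₀ he]
    have := hle b
    by_contra hc
    push Not at hc
    nlinarith [norm_nonneg (y b)]
  have ha : e * ‖y a‖ ^ 2 ≤ 1 / e := (hle a).trans hb
  have : ‖y a‖ ^ 2 ≤ (1 / e) ^ 2 := by
    rw [sq (1 / e), ← div_eq_mul_one_div, le_div_iff₀ he]; linarith
  exact (sq_le_sq₀ (norm_nonneg _) (by positivity)).mp this

lemma resM_ratio_bdd (hK : K.IsHermitian) (hlam : 0 ≤ lam) (z z' : ℂ) (e : ℝ) (he : 0 < e) :
    ∃ C : ℝ, ∀ w : ι → ℂ, (∀ j, e ≤ z'.im - lam * (w j).im) →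
      ‖(resM K lam z w).det / (resM K lam z' w).det‖ ≤ C := by
  refine ⟨(Fintype.card ι).factorial • (1 + ‖z - z'‖ * (1 / e)) ^ (Fintype.card ι), fun w hw => ?_⟩
  have hdet := resM_det_ne K lam hK hlam z' e he w hw
  have e1 : (resM K lam z w).det / (resM K lam z' w).det =
      (1 + (z - z') • (resM K lam z' w)⁻¹).det := by
    rw [div_eq_iff hdet, ← Matrix.det_mul, Matrix.add_mul, Matrix.smul_mul,
      Matrix.nonsing_inv_mul _ (isUnit_iff_ne_zero.mpr hdet), one_mul]
    congr 1
    simp only [resM, sub_smul]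
    abel
  rw [e1]
  refine Matrix.det_le (abv := NormedField.toAbsoluteValue ℂ) (fun a b => ?_)
  change ‖(1 + (z - z') • (resM K lam z' w)⁻¹ : Matrix ι ι ℂ) a b‖ ≤ _
  rw [Matrix.add_apply, Matrix.smul_apply, smul_eq_mul]
  refine (norm_add_le _ _).trans ?_
  rw [norm_mul]
  gcongr
  · rw [Matrix.one_apply]; split_ifs <;> simp
  · exact resM_inv_le K lam hK hlam z' e he w hw a b

lemma resM_det_continuous : Continuous (fun p : ℂ × (ι → ℂ) => (resM K lam p.1 p.2).det) := by
  refine Continuous.matrix_det ?_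
  unfold resM
  fun_prop

lemma resM_avg (hK : K.IsHermitian) (hlam : 0 ≤ lam) (z z' : ℂ) (hz : 0 < z'.im) :
    ∫ V : ι → ℝ, (resM K lam z (fun j => (V j : ℂ))).det / (resM K lam z' (fun j => (V j : ℂ))).det
      ∂(Measure.pi fun _ => cauchy) =
    (resM K lam z (fun _ => -Complex.I)).det / (resM K lam z' (fun _ => -Complex.I)).det := by
  obtain ⟨C, hC⟩ := resM_ratio_bdd K lam hK hlam z z' z'.im hz
  have him : ∀ w : ι → ℂ, (∀ j, (w j).im ≤ 0) → ∀ j, z'.im ≤ z'.im - lam * (w j).im := by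
    intro w hw j
    have := mul_nonpos_of_nonneg_of_nonpos hlam (hw j)
    linarith
  have hc : ∀ z, Continuous (fun w : ι → ℂ => (resM K lam z w).det) := fun z =>
    (resM_det_continuous K lam).comp (by fun_prop : Continuous fun w : ι → ℂ => (z, w))
  refine pi_avg (fun w => (resM K lam z w).det / (resM K lam z' w).det)
    ((hc z).measurable.div (hc z').measurable) C (fun w hw => hC w (him w hw)) ?_
  intro w j hw
  obtain ⟨α, β, hP⟩ := resM_affine K lam z w j
  obtain ⟨γ, δ, hQ⟩ := resM_affine K lam z' w j
  have hu : ∀ t : ℂ, t.im ≤ 0 → ∀ i, (Function.update w j t i).im ≤ 0 := by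
    intro t ht i
    by_cases h : i = j
    · subst h; simpa using ht
    · rw [Function.update_of_ne h]; exact hw i
  simp only [hP, hQ]
  refine cauchy_mobius α β γ δ (fun t ht => ?_) C (fun x => ?_)
  · rw [← hQ]
    exact resM_det_ne K lam hK hlam z' _ hz _ (him _ (hu t ht))
  · rw [← hQ, ← hP]
    exact hC _ (him _ (hu _ (by simp)))

end

lemma lap_herm {d : ℕ} (Λ : Finset (Fin d → ℤ)) : (lap Λ).IsHermitian := by
  ext a b
  have hd : dist1 (b : Fin d → ℤ) a = dist1 (a : Fin d → ℤ) b := by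
    simp [dist1, abs_sub_comm]
  simp only [Matrix.conjTranspose_apply, lap, lapE, hd]
  by_cases h : (a : Fin d → ℤ) = b
  · simp [h, apply_ite]
  · simp [h, Ne.symm h, apply_ite]

/-- Theorem 2.6, classical Lloyd model, generating function.
For the Anderson Hamiltonian `H_Λ = -Δ + λV` on a finite cube `Λ ⊂ ℤ^d` with i.i.d.
standard Cauchy potential, the generating function
`𝒢_ε(E,Etil) = 𝔼[det((E+iε)1 - H_Λ)/det((Etil+iε)1 - H_Λ)]` converges, as `ε → 0⁺`, to
`det((E+iλ)1 - H₀)/det((Etil+iλ)1 - H₀)` where `H₀ = -Δ`. -/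
theorem lloyd_generating_function (d L : ℕ) (hd : 1 ≤ d)
    (lam : ℝ) (hlam : 0 < lam) (E Etil : ℝ) :
    Tendsto
      (fun ε : ℝ =>
        ∫ V : ↥(cube d L) → ℝ,
          Matrix.det ((((E : ℂ) + ε * Complex.I) • (1 : Matrix (cube d L) (cube d L) ℂ)) -
              (-(lap (cube d L)) + Matrix.diagonal (fun j => (lam : ℂ) * (V j : ℂ)))) /
          Matrix.det ((((Etil : ℂ) + ε * Complex.I) • (1 : Matrix (cube d L) (cube d L) ℂ)) -
              (-(lap (cube d L)) + Matrix.diagonal (fun j => (lam : ℂ) * (V j : ℂ))))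
          ∂(Measure.pi fun _ => cauchy))
      (nhdsWithin 0 (Set.Ioi 0))
      (nhds
        (Matrix.det ((((E : ℂ) + lam * Complex.I) • (1 : Matrix (cube d L) (cube d L) ℂ)) -
            (-(lap (cube d L)))) /
         Matrix.det ((((Etil : ℂ) + lam * Complex.I) • (1 : Matrix (cube d L) (cube d L) ℂ)) -
            (-(lap (cube d L)))))) := by
  have hK := lap_herm (cube d L)
  have key : ∀ ε : ℝ, 0 < ε → _ := fun ε hε => resM_avg (lap (cube d L)) lam hK hlam.le
    ((E : ℂ) + ε * Complex.I) ((Etil : ℂ) + ε * Complex.I) (by simpa using hε)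
  have hc : ∀ x : ℝ, Continuous (fun ε : ℝ =>
      (resM (lap (cube d L)) lam ((x : ℂ) + ε * Complex.I) (fun _ => -Complex.I)).det) := fun x =>
    (resM_det_continuous (lap (cube d L)) lam).comp
      (by fun_prop : Continuous fun ε : ℝ => ((x : ℂ) + ε * Complex.I, fun _ => -Complex.I))
  have h0 : ∀ x : ℝ, resM (lap (cube d L)) lam ((x : ℂ) + (0 : ℝ) * Complex.I)
      (fun _ => -Complex.I) =
      (((x : ℂ) + lam * Complex.I) • (1 : Matrix (cube d L) (cube d L) ℂ)) -
            (-(lap (cube d L))) := by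
    intro x
    ext a b
    by_cases h : a = b
    · subst h; simp [resM]; ring
    · simp [resM, h]
  have hne : (resM (lap (cube d L)) lam ((Etil : ℂ) + (0 : ℝ) * Complex.I)
      (fun _ => -Complex.I)).det ≠ 0 :=
    resM_det_ne _ lam hK hlam.le _ lam hlam _ (by simp)
  have lim := ((hc E).tendsto 0).div ((hc Etil).tendsto 0) hne
  rw [h0, h0] at lim
  refine Tendsto.congr' ?_ (lim.mono_left nhdsWithin_le_nhds)
  filter_upwards [self_mem_nhdsWithin] with ε hε
  exact (key ε hε).symm
end
end

section
/- Let d ≥ 1, let Λ ⊂ ℤ^d be a finite cube, let λ > 0 and E ∈ ℝ. Let {V_j}_{j∈Λ} be i.i.d. standard Cauchy random variables and H_Λ = −Δ + λV. Then lim_{ε→0⁺} E[ Tr ((E+iε)·1_Λ − H_Λ)^{−1} ] = Tr ((E+iλ)·1_Λ − H₀)^{−1}, where H₀ = −Δ. In particular the classical Lloyd model has the same averaged density of states as the free Laplacian H₀ with imaginary mass λ. -/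
open MeasureTheory Matrix Filter

noncomputable section

lemma cauchy_integral (g : ℝ → ℂ) :
    ∫ v, g v ∂cauchy = ∫ v : ℝ, (1 / (Real.pi * (1 + v ^ 2))) • g v := by
  unfold cauchy
  rw [integral_withDensity_eq_integral_toReal_smul (by fun_prop) (by simp)]
  congr 1
  ext v
  rw [ENNReal.toReal_ofReal (by positivity)]

instance cauchy_prob : IsProbabilityMeasure cauchy := by
  constructor
  unfold cauchy
  rw [withDensity_apply _ MeasurableSet.univ, Measure.restrict_univ,
    ← ofReal_integral_eq_lintegral_ofReal]
  · have : ∫ v : ℝ, 1 / (Real.pi * (1 + v ^ 2)) = 1 := by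
      simp only [one_div, mul_inv]
      rw [integral_const_mul, integral_univ_inv_one_add_sq, inv_mul_cancel₀ Real.pi_ne_zero]
    rw [this]; simp
  · simp only [one_div, mul_inv]
    exact integrable_inv_one_add_sq.const_mul _
  · exact Eventually.of_forall fun v => by positivity

lemma change_var (h : ℂ → ℂ) :
    ∫ θ in (0 : ℝ)..(2 * Real.pi), h (circleMap 0 1 θ) =
      ∫ v : ℝ, (2 / (1 + v ^ 2)) • h (circleMap 0 1 (Real.pi - 2 * Real.arctan v)) := by
  have hd : ∀ v ∈ (Set.univ : Set ℝ), HasDerivWithinAt (fun v => Real.pi - 2 * Real.arctan v)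
      (-(2 * (1 / (1 + v ^ 2)))) Set.univ v := fun v _ =>
    (((Real.hasDerivAt_arctan v).const_mul 2).const_sub _).hasDerivWithinAt
  have hinj : Set.InjOn (fun v => Real.pi - 2 * Real.arctan v) Set.univ := by
    intro a _ b _ hab
    apply Real.arctan_injective
    simp only at hab
    linarith
  have himg : (fun v => Real.pi - 2 * Real.arctan v) '' Set.univ = Set.Ioo 0 (2 * Real.pi) := by
    ext x
    constructor
    · rintro ⟨v, -, rfl⟩
      have h1 := Real.arctan_lt_pi_div_two v
      have h2 := Real.neg_pi_div_two_lt_arctan v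
      constructor <;> simp only <;> linarith
    · rintro ⟨h1, h2⟩
      refine ⟨Real.tan ((Real.pi - x) / 2), trivial, ?_⟩
      simp only
      rw [Real.arctan_tan (by linarith) (by linarith)]
      ring
  have key := integral_image_eq_integral_abs_deriv_smul MeasurableSet.univ hd hinj
    (fun θ => h (circleMap 0 1 θ))
  rw [himg, Measure.restrict_univ] at key
  rw [intervalIntegral.integral_of_le (by positivity), integral_Ioc_eq_integral_Ioo, key]
  congr 1
  ext v
  rw [abs_neg, abs_of_nonneg (by positivity)]
  congr 1
  ring

/-- Cayley transform from the disc to the lower half-plane. -/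
def cay (ζ : ℂ) : ℂ := Complex.I * (ζ + 1) / (ζ - 1)

lemma cay_im (ζ : ℂ) (h : ‖ζ‖ ≤ 1) : (cay ζ).im ≤ 0 := by
  have h2 : ζ.re * ζ.re + ζ.im * ζ.im ≤ 1 := by
    have := Complex.normSq_eq_norm_sq ζ
    rw [Complex.normSq_apply] at this
    rw [this]
    nlinarith [norm_nonneg ζ]
  unfold cay
  rw [Complex.div_im, ← sub_div]
  refine div_nonpos_of_nonpos_of_nonneg ?_ (Complex.normSq_nonneg _)
  simp
  nlinarith

lemma cay_circle (v : ℝ) : cay (circleMap 0 1 (Real.pi - 2 * Real.arctan v)) = v := by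
  have hc := Real.cos_arctan_pos v
  have ht : Real.sin (Real.arctan v) = v * Real.cos (Real.arctan v) := by
    rw [Real.sin_arctan, Real.cos_arctan]; ring
  set a := Real.arctan v
  have hs := Real.sin_sq_add_cos_sq a
  have hz : circleMap 0 1 (Real.pi - 2 * a) =
      ((1 - 2 * Real.cos a ^ 2 : ℝ) : ℂ) + ((2 * v * Real.cos a ^ 2 : ℝ) : ℂ) * Complex.I := by
    rw [circleMap, Complex.ofReal_one, one_mul, zero_add, Complex.exp_mul_I,
      ← Complex.ofReal_cos, ← Complex.ofReal_sin, Real.cos_pi_sub, Real.sin_pi_sub,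
      Real.cos_two_mul, Real.sin_two_mul, ht]
    push_cast; ring
  have hv : Real.cos a ^ 2 * (1 + v ^ 2) = 1 := by rw [ht] at hs; linarith
  rw [hz]
  generalize Real.cos a = c at *
  unfold cay
  have hne : ((1 - 2 * c ^ 2 : ℝ) : ℂ) + ((2 * v * c ^ 2 : ℝ) : ℂ) * Complex.I - 1 ≠ 0 := by
    intro h0
    have := congrArg Complex.re h0
    simp [-Complex.ofReal_sub, -Complex.ofReal_mul] at this
    exact hc.ne' this
  rw [div_eq_iff hne]
  apply Complex.ext
  · simp [-Complex.ofReal_sub, -Complex.ofReal_mul]; ring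
  · simp [-Complex.ofReal_sub, -Complex.ofReal_mul]; linarith

lemma cauchy_mean (g : ℂ → ℂ) (C : ℝ) (hg : ∀ v : ℂ, v.im ≤ 0 → DifferentiableAt ℂ g v)
    (hC : ∀ v : ℂ, v.im ≤ 0 → ‖g v‖ ≤ C) :
    ∫ v : ℝ, g v ∂cauchy = g (-Complex.I) := by
  have hdiff : ∀ ζ : ℂ, ‖ζ‖ ≤ 1 → ζ ≠ 1 → DifferentiableAt ℂ (fun ζ => g (cay ζ)) ζ := by
    intro ζ h1 h2
    have : DifferentiableAt ℂ cay ζ := by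
      unfold cay
      have : ζ - 1 ≠ 0 := sub_ne_zero.2 h2
      fun_prop (disch := assumption)
    exact (hg _ (cay_im ζ h1)).comp ζ this
  have hmean : ∀ r ∈ Set.Ioo (0 : ℝ) 1,
      ∫ θ in (0 : ℝ)..(2 * Real.pi), g (cay (circleMap 0 r θ)) =
        (2 * Real.pi) • g (-Complex.I) := by
    intro r hr
    have hd : DifferentiableOn ℂ (fun ζ => g (cay ζ)) (closure (Metric.ball 0 |r|)) := by
      intro ζ hζ
      have hζ' := Metric.closure_ball_subset_closedBall hζ
      rw [mem_closedBall_zero_iff, abs_of_pos hr.1] at hζ'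
      refine (hdiff ζ (hζ'.trans hr.2.le) ?_).differentiableWithinAt
      rintro rfl
      simp at hζ'
      linarith [hr.2]
    have := hd.diffContOnCl.circleAverage
    rw [Real.circleAverage_def, inv_smul_eq_iff₀ (by positivity)] at this
    rw [this]
    simp [cay, div_neg]
  have hlim : Tendsto (fun r : ℝ => ∫ θ in (0 : ℝ)..(2 * Real.pi), g (cay (circleMap 0 r θ)))
      (nhdsWithin 1 (Set.Iio 1))
      (nhds (∫ θ in (0 : ℝ)..(2 * Real.pi), g (cay (circleMap 0 1 θ)))) := by
    have hev : ∀ᶠ r : ℝ in nhdsWithin 1 (Set.Iio 1), r ∈ Set.Ioo (0 : ℝ) 1 :=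
      Ioo_mem_nhdsLT one_pos
    apply intervalIntegral.tendsto_integral_filter_of_dominated_convergence (fun _ => C)
    · filter_upwards [hev] with r hr
      apply Continuous.aestronglyMeasurable
      rw [continuous_iff_continuousAt]
      intro θ
      have hn : ‖circleMap 0 r θ‖ = r := by simp [abs_of_pos hr.1]
      refine ContinuousAt.comp (f := circleMap 0 r) (g := fun ζ => g (cay ζ))
        (hdiff _ (hn.le.trans hr.2.le) ?_).continuousAt
        (continuous_circleMap 0 r).continuousAt
      intro h
      rw [h] at hn
      simp at hn
      linarith [hr.2]
    · filter_upwards [hev] with r hr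
      refine Eventually.of_forall fun θ _ => hC _ (cay_im _ ?_)
      simp [abs_of_pos hr.1, hr.2.le]
    · simp
    · have h0 : ∀ᵐ θ : ℝ, θ ≠ 2 * Real.pi := by
        simp [ae_iff]
      filter_upwards [h0] with θ hθ hm
      rw [Set.uIoc_of_le (by positivity)] at hm
      have hne : circleMap 0 1 θ ≠ 1 := by
        intro h
        simp only [circleMap, Complex.ofReal_one, one_mul, zero_add] at h
        obtain ⟨n, hn⟩ := Complex.exp_eq_one_iff.1 h
        have hn' : θ = n * (2 * Real.pi) := by
          have := congrArg Complex.im hn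
          simpa using this
        have hp := Real.pi_pos
        have hlt : θ < 2 * Real.pi := lt_of_le_of_ne hm.2 hθ
        have h1 : (0 : ℝ) < n := by
          by_contra hc
          nlinarith [hm.1]
        have h2 : (n : ℝ) < 1 := by
          by_contra hc
          nlinarith
        have h1' : 0 < n := by exact_mod_cast h1
        have h2' : n < 1 := by exact_mod_cast h2
        omega
      have hc : ContinuousAt (fun r : ℝ => circleMap 0 r θ) 1 := by
        unfold circleMap
        fun_prop
      exact (ContinuousAt.comp (f := fun r : ℝ => circleMap 0 r θ) (g := fun ζ => g (cay ζ))
        (hdiff _ (by simp) hne).continuousAt hc).tendsto.mono_left nhdsWithin_le_nhds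
  have hev : ∀ᶠ r : ℝ in nhdsWithin 1 (Set.Iio 1), r ∈ Set.Ioo (0 : ℝ) 1 :=
    Ioo_mem_nhdsLT one_pos
  have heq : ∫ θ in (0 : ℝ)..(2 * Real.pi), g (cay (circleMap 0 1 θ)) =
      (2 * Real.pi) • g (-Complex.I) := by
    refine tendsto_nhds_unique hlim (tendsto_const_nhds.congr' ?_)
    filter_upwards [hev] with r hr
    exact (hmean r hr).symm
  rw [change_var (fun ζ => g (cay ζ))] at heq
  simp only [cay_circle] at heq
  rw [cauchy_integral, ← inv_smul_eq_iff₀ (by positivity), ← integral_smul] at *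
  rw [← heq]
  congr 1
  ext v
  rw [smul_smul]
  congr 1
  have := Real.pi_ne_zero
  have : 1 + v ^ 2 ≠ 0 := by positivity
  field_simp

section abstractpart

variable {ι : Type*} [Fintype ι] [DecidableEq ι]

lemma mp_update (μ : Measure ℝ) [IsProbabilityMeasure μ] (j : ι) :
    MeasurePreserving (fun p : (ι → ℝ) × ℝ => Function.update p.1 j p.2)
      ((Measure.pi fun _ => μ).prod μ) (Measure.pi fun _ => μ) := by
  have hm : Measurable (fun p : (ι → ℝ) × ℝ => Function.update p.1 j p.2) := by
    rw [measurable_pi_iff]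
    intro i
    by_cases h : i = j
    · subst h; simpa using measurable_snd
    · simp only [Function.update_of_ne h]
      exact (measurable_pi_apply i).comp measurable_fst
  refine ⟨hm, ?_⟩
  symm
  apply Measure.pi_eq
  intro s hs
  rw [Measure.map_apply hm (MeasurableSet.univ_pi hs)]
  have : (fun p : (ι → ℝ) × ℝ => Function.update p.1 j p.2) ⁻¹' (Set.univ.pi s) =
      (Set.univ.pi (Function.update s j Set.univ)) ×ˢ (s j) := by
    ext ⟨V, v⟩
    simp only [Set.mem_preimage, Set.mem_pi, Set.mem_univ, true_imp_iff, Set.mem_prod]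
    constructor
    · intro h
      refine ⟨fun i => ?_, by simpa using h j⟩
      by_cases hi : i = j
      · subst hi; simp
      · simpa [Function.update_of_ne hi] using h i
    · rintro ⟨h1, h2⟩ i
      by_cases hi : i = j
      · subst hi; simpa using h2
      · simpa [Function.update_of_ne hi] using h1 i
  rw [this, Measure.prod_prod, Measure.pi_pi, ← Finset.prod_erase_mul _ _ (Finset.mem_univ j),
    ← Finset.prod_erase_mul _ (fun i => μ (s i)) (Finset.mem_univ j)]
  simp only [Function.update_self, measure_univ, mul_one]
  congr 1
  apply Finset.prod_congr rfl
  intro i hi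
  rw [Function.update_of_ne (Finset.ne_of_mem_erase hi)]

/-- partially substituted point -/
def psub (S : Finset ι) (V : ι → ℝ) : ι → ℂ :=
  fun i => if i ∈ S then -Complex.I else (V i : ℂ)

lemma psub_im (S : Finset ι) (V : ι → ℝ) (i : ι) : (psub S V i).im ≤ 0 := by
  unfold psub
  split_ifs <;> simp

lemma psub_cont (S : Finset ι) : Continuous (psub S) := by
  apply continuous_pi
  intro i
  unfold psub
  split_ifs <;> fun_prop

lemma multi_mean (f : (ι → ℂ) → ℂ) (C : ℝ)
    (hC : ∀ w : ι → ℂ, (∀ i, (w i).im ≤ 0) → ‖f w‖ ≤ C)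
    (hcont : ∀ w : ι → ℂ, (∀ i, (w i).im ≤ 0) → ContinuousAt f w)
    (hd : ∀ w : ι → ℂ, (∀ i, (w i).im ≤ 0) → ∀ j, ∀ v : ℂ, v.im ≤ 0 →
      DifferentiableAt ℂ (fun v => f (Function.update w j v)) v) :
    ∫ V : ι → ℝ, f (fun i => (V i : ℂ)) ∂(Measure.pi fun _ => cauchy) =
      f (fun _ => -Complex.I) := by
  have hcS : ∀ S : Finset ι, Continuous (fun V => f (psub S V)) := by
    intro S
    rw [continuous_iff_continuousAt]
    intro V
    exact ContinuousAt.comp (hcont _ (psub_im S V)) (psub_cont S).continuousAt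
  have hint : ∀ S : Finset ι,
      Integrable (fun V => f (psub S V)) (Measure.pi fun _ => cauchy) := by
    intro S
    exact Integrable.of_bound (hcS S).aestronglyMeasurable C
      (Eventually.of_forall fun V => hC _ (psub_im S V))
  have key : ∀ S : Finset ι, ∫ V : ι → ℝ, f (fun i => (V i : ℂ)) ∂(Measure.pi fun _ => cauchy) =
      ∫ V : ι → ℝ, f (psub S V) ∂(Measure.pi fun _ => cauchy) := by
    intro S
    induction S using Finset.induction_on with
    | empty => unfold psub; simp
    | insert j S hj ih =>
      rw [ih]
      have mp := mp_update (ι := ι) cauchy j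
      have h1 : ∫ V : ι → ℝ, f (psub S V) ∂(Measure.pi fun _ => cauchy) =
          ∫ p : (ι → ℝ) × ℝ, f (psub S (Function.update p.1 j p.2))
            ∂((Measure.pi fun _ => cauchy).prod cauchy) := by
        conv_lhs => rw [← mp.map_eq]
        exact integral_map mp.measurable.aemeasurable (hcS S).aestronglyMeasurable
      have h2 : Integrable (fun p : (ι → ℝ) × ℝ => f (psub S (Function.update p.1 j p.2)))
          ((Measure.pi fun _ => cauchy).prod cauchy) :=
        mp.integrable_comp_of_integrable (hint S)
      rw [h1, integral_prod _ h2]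
      congr 1
      ext V
      have h3 : ∀ v : ℝ, psub S (Function.update V j v) = Function.update (psub S V) j (v : ℂ) := by
        intro v
        ext i
        by_cases hi : i = j
        · subst hi; simp [psub, hj]
        · simp [psub, Function.update_of_ne hi]
      have h4 : psub (insert j S) V = Function.update (psub S V) j (-Complex.I) := by
        ext i
        by_cases hi : i = j
        · subst hi; simp [psub]
        · simp [psub, Function.update_of_ne hi, hi]
      simp only [h3, h4]
      apply cauchy_mean (fun v => f (Function.update (psub S V) j v)) C
      · exact hd _ (psub_im S V) j
      · intro v hv
        apply hC
        intro i
        by_cases hi : i = j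
        · subst hi; simpa using hv
        · simpa [Function.update_of_ne hi] using psub_im S V i
  rw [key Finset.univ]
  unfold psub
  simp

lemma quad_im (B : Matrix ι ι ℂ) (hB : B.IsHermitian) (z x : ι → ℂ) :
    (star x ⬝ᵥ ((diagonal z + B) *ᵥ x)).im = ∑ j, (z j).im * ‖x j‖ ^ 2 := by
  have h := hB.im_star_dotProduct_mulVec_self x
  rw [add_mulVec, dotProduct_add, Complex.add_im]
  simp only [RCLike.im_to_complex] at h
  rw [h, add_zero, dotProduct, Complex.im_sum]
  apply Finset.sum_congr rfl
  intro j _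
  rw [mulVec_diagonal, ← Complex.normSq_eq_norm_sq, Complex.normSq_apply]
  simp
  ring

lemma det_ne (B : Matrix ι ι ℂ) (hB : B.IsHermitian) (z : ι → ℂ) (hz : ∀ j, 0 < (z j).im) :
    (diagonal z + B).det ≠ 0 := by
  intro h0
  obtain ⟨x, hx, hx0⟩ := exists_mulVec_eq_zero_iff.2 h0
  have h := quad_im B hB z x
  rw [hx0, dotProduct_zero, Complex.zero_im] at h
  obtain ⟨k, hk⟩ := Function.ne_iff.1 hx
  have : 0 < ∑ j, (z j).im * ‖x j‖ ^ 2 := by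
    apply Finset.sum_pos' (fun j _ => mul_nonneg (hz j).le (by positivity))
    exact ⟨k, Finset.mem_univ _, mul_pos (hz k) (by have := norm_pos_iff.2 hk; positivity)⟩
  linarith

lemma diag_bound (B : Matrix ι ι ℂ) (hB : B.IsHermitian) (z : ι → ℂ) (ε : ℝ) (hε : 0 < ε)
    (hz : ∀ j, ε ≤ (z j).im) (k : ι) : ‖(diagonal z + B)⁻¹ k k‖ ≤ 1 / ε := by
  have hdet := det_ne B hB z fun j => hε.trans_le (hz j)
  set M := diagonal z + B with hM
  have hu : IsUnit M.det := isUnit_iff_ne_zero.2 hdet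
  let x : ι → ℂ := M⁻¹ *ᵥ Pi.single k 1
  have hx : M *ᵥ x = Pi.single k 1 := by
    simp only [x]
    rw [mulVec_mulVec, mul_nonsing_inv _ hu, one_mulVec]
  have hxk : x k = M⁻¹ k k := by simp [x]
  have h := quad_im B hB z x
  rw [← hM, hx] at h
  simp at h
  rw [← hxk]
  have h1 : ε * ‖x k‖ ^ 2 ≤ ‖x k‖ := by
    calc ε * ‖x k‖ ^ 2 ≤ (z k).im * ‖x k‖ ^ 2 :=
          mul_le_mul_of_nonneg_right (hz k) (by positivity)
      _ ≤ ∑ j, (z j).im * ‖x j‖ ^ 2 :=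
          Finset.single_le_sum (f := fun j => (z j).im * ‖x j‖ ^ 2)
            (fun j _ => mul_nonneg (hε.le.trans (hz j)) (by positivity)) (Finset.mem_univ k)
      _ = -(x k).im := h.symm
      _ ≤ |(x k).im| := neg_le_abs _
      _ ≤ ‖x k‖ := Complex.abs_im_le_norm _
  rw [le_div_iff₀ hε]
  rcases (norm_nonneg (x k)).eq_or_lt with h0 | h0
  · rw [← h0]; simp
  · nlinarith

lemma trace_bound (B : Matrix ι ι ℂ) (hB : B.IsHermitian) (z : ι → ℂ) (ε : ℝ) (hε : 0 < ε)
    (hz : ∀ j, ε ≤ (z j).im) : ‖trace (diagonal z + B)⁻¹‖ ≤ Fintype.card ι * (1 / ε) := by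
  rw [trace]
  refine (norm_sum_le _ _).trans ?_
  refine (Finset.sum_le_card_nsmul _ _ (1 / ε) fun k _ => diag_bound B hB z ε hε hz k).trans ?_
  simp

lemma det_diff (A : ℂ → Matrix ι ι ℂ) (v : ℂ)
    (h : ∀ i j, DifferentiableAt ℂ (fun v => A v i j) v) :
    DifferentiableAt ℂ (fun v => (A v).det) v := by
  simp only [det_apply]
  apply DifferentiableAt.fun_sum
  intro σ _
  apply DifferentiableAt.const_smul
  apply DifferentiableAt.fun_finsetProd
  intro i _
  exact h _ _

lemma trace_inv_diff (A : ℂ → Matrix ι ι ℂ) (v : ℂ)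
    (h : ∀ i j, DifferentiableAt ℂ (fun v => A v i j) v) (h0 : (A v).det ≠ 0) :
    DifferentiableAt ℂ (fun v => trace (A v)⁻¹) v := by
  simp only [inv_def, Ring.inverse_eq_inv', trace_smul, smul_eq_mul]
  apply DifferentiableAt.mul
  · exact (det_diff A v h).inv h0
  · simp only [trace, diag]
    apply DifferentiableAt.fun_sum
    intro i _
    simp only [adjugate_apply]
    apply det_diff
    intro a b
    simp only [updateRow_apply]
    split_ifs
    · exact differentiableAt_const _
    · exact h _ _

lemma trace_inv_cont {X : Type*} [TopologicalSpace X] (A : X → Matrix ι ι ℂ) (v : X)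
    (h : Continuous A) (h0 : (A v).det ≠ 0) :
    ContinuousAt (fun v => trace (A v)⁻¹) v := by
  simp only [inv_def, Ring.inverse_eq_inv', trace_smul, smul_eq_mul]
  exact (h.matrix_det.continuousAt.inv₀ h0).mul h.matrix_adjugate.matrix_trace.continuousAt

lemma averaged (B : Matrix ι ι ℂ) (hB : B.IsHermitian) (lam : ℝ) (hlam : 0 < lam) (E ε : ℝ)
    (hε : 0 < ε) :
    ∫ V : ι → ℝ, trace (diagonal (fun j => (E : ℂ) + ε * Complex.I - lam * (V j : ℂ)) + B)⁻¹
      ∂(Measure.pi fun _ => cauchy) =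
    trace (diagonal (fun _ => (E : ℂ) + ε * Complex.I - lam * (-Complex.I)) + B)⁻¹ := by
  have him : ∀ w : ι → ℂ, (∀ i, (w i).im ≤ 0) → ∀ j,
      ε ≤ ((E : ℂ) + ε * Complex.I - lam * (w j)).im := by
    intro w hw j
    simp
    nlinarith [hw j]
  have hdet := fun w hw => det_ne B hB _ fun j => hε.trans_le (him w hw j)
  refine multi_mean
    (fun w => trace (diagonal (fun j => (E : ℂ) + ε * Complex.I - lam * (w j)) + B)⁻¹)
    (Fintype.card ι * (1 / ε)) ?_ ?_ ?_
  · intro w hw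
    exact trace_bound B hB _ ε hε (him w hw)
  · intro w hw
    refine trace_inv_cont (fun w : ι → ℂ =>
      diagonal (fun j => (E : ℂ) + ε * Complex.I - lam * (w j)) + B) w ?_ (hdet w hw)
    apply Continuous.add _ continuous_const
    apply Continuous.matrix_diagonal
    fun_prop
  · intro w hw j v hv
    apply trace_inv_diff
    · intro a b
      simp only [Matrix.add_apply, diagonal_apply]
      apply DifferentiableAt.add_const
      split_ifs
      · by_cases ha : a = j
        · subst ha
          simp only [Function.update_self]
          fun_prop
        · simp only [Function.update_of_ne ha]
          exact differentiableAt_const _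
      · exact differentiableAt_const _
    · apply hdet
      intro i
      by_cases hi : i = j
      · subst hi; simpa using hv
      · simpa [Function.update_of_ne hi] using hw i

end abstractpart

/-- Theorem 2.6, classical Lloyd model, averaged Green's function.
For the Anderson Hamiltonian `H_Λ = -Δ + λV` on a finite cube `Λ ⊂ ℤ^d` with i.i.d.
standard Cauchy potential, `lim_{ε→0⁺} 𝔼[Tr((E+iε)1 - H_Λ)⁻¹] = Tr((E+iλ)1 - H₀)⁻¹`,
where `H₀ = -Δ`: the classical Lloyd model has the same averaged density of states
as the free Laplacian with imaginary mass `λ`. -/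
theorem lloyd_averaged_green (d L : ℕ) (hd : 1 ≤ d)
    (lam : ℝ) (hlam : 0 < lam) (E : ℝ) :
    Tendsto
      (fun ε : ℝ =>
        ∫ V : ↥(cube d L) → ℝ,
          Matrix.trace
            (((((E : ℂ) + ε * Complex.I) • (1 : Matrix (cube d L) (cube d L) ℂ)) -
              (-(lap (cube d L)) + Matrix.diagonal (fun j => (lam : ℂ) * (V j : ℂ))))⁻¹)
          ∂(Measure.pi fun _ => cauchy))
      (nhdsWithin 0 (Set.Ioi 0))
      (nhds
        (Matrix.trace
          (((((E : ℂ) + lam * Complex.I) • (1 : Matrix (cube d L) (cube d L) ℂ)) -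
            (-(lap (cube d L))))⁻¹))) := by
  have hB := lap_herm (cube d L)
  set B := lap (cube d L) with hBdef
  have hlimit : ContinuousAt (fun ε : ℝ => trace (diagonal (fun _ : cube d L =>
      (E : ℂ) + ε * Complex.I - lam * (-Complex.I)) + B)⁻¹) 0 := by
    apply trace_inv_cont
    · apply Continuous.add _ continuous_const
      apply Continuous.matrix_diagonal
      fun_prop
    · apply det_ne B hB
      intro j
      simpa using hlam
  have hval : trace (diagonal (fun _ : cube d L =>
      (E : ℂ) + (0 : ℝ) * Complex.I - lam * (-Complex.I)) + B)⁻¹ =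
      trace (((((E : ℂ) + lam * Complex.I) • (1 : Matrix (cube d L) (cube d L) ℂ)) - (-B))⁻¹) := by
    rw [smul_one_eq_diagonal, sub_neg_eq_add]
    simp
  have ht := hlimit.tendsto.mono_left (nhdsWithin_le_nhds (s := Set.Ioi 0))
  rw [hval] at ht
  refine ht.congr' ?_
  filter_upwards [self_mem_nhdsWithin] with ε hε
  rw [← averaged B hB lam hlam E ε hε]
  congr 1
  ext V
  congr 2
  rw [smul_one_eq_diagonal, sub_add_eq_sub_sub, sub_neg_eq_add, add_sub_right_comm,
    diagonal_sub]
end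
end

section
/- Complex Gaussian integral formulas: let n ≥ 1 and A ∈ ℂ^{n×n} with positive definite Hermitian part, i.e. Re ⟨z, Az⟩ > 0 for all z ∈ ℂ^n ∖ {0}. Then (i) π^{−n} ∫_{ℂ^n} e^{−⟨z, Az⟩} dm(z) = 1/det A, and (ii) for all indices j, k: (A^{−1})_{jk} = det A · π^{−n} ∫_{ℂ^n} \bar{z}_k z_j e^{−⟨z, Az⟩} dm(z), where m is Lebesgue measure on ℂ^n ≅ ℝ^{2n} and ⟨z, Az⟩ = Σ_{j,k} \bar{z}_j A_{jk} z_k. In particular both integrals converge absolutely. -/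
open MeasureTheory Matrix

noncomputable section

lemma g0_int {b : ℂ} (hb : 0 < b.re) :
    Integrable (fun w : ℂ => Complex.exp (-b * (‖w‖:ℂ) ^ 2)) := by
  simpa using GaussianFourier.integrable_cexp_neg_mul_sq_norm_add (V := ℂ) hb 0 0

lemma g0_val {b : ℂ} (hb : 0 < b.re) :
    ∫ w : ℂ, Complex.exp (-b * (‖w‖:ℂ) ^ 2) = Real.pi / b := by
  simpa using GaussianFourier.integral_cexp_neg_mul_sq_norm (V := ℂ) hb

lemma g_norm (b : ℂ) (y : ℝ) :
    ‖Complex.exp (-b * (y:ℂ) ^ 2)‖ = Real.exp (-(b.re * y ^ 2)) := by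
  rw [Complex.norm_exp, ← Complex.ofReal_pow, Complex.re_mul_ofReal]; simp

lemma g2_int {b : ℂ} (hb : 0 < b.re) :
    Integrable (fun w : ℂ => (‖w‖:ℂ) ^ 2 * Complex.exp (-b * (‖w‖:ℂ) ^ 2)) := by
  have h2 : 0 < (b / 2).re := by simpa using hb
  have hb2 : (b / 2).re = b.re / 2 := by simp
  refine ((g0_int h2).norm.const_mul (2 / b.re)).mono' (by fun_prop) ?_
  refine Filter.Eventually.of_forall fun w => ?_
  rw [norm_mul, g_norm, g_norm, hb2]
  have h3 : b.re / 2 * ‖w‖ ^ 2 ≤ Real.exp (b.re / 2 * ‖w‖ ^ 2) := by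
    linarith [Real.add_one_le_exp (b.re / 2 * ‖w‖ ^ 2)]
  have h4 : ‖w‖ ^ 2 ≤ 2 / b.re * Real.exp (b.re / 2 * ‖w‖ ^ 2) := by
    calc ‖w‖ ^ 2 = 2 / b.re * (b.re / 2 * ‖w‖ ^ 2) := by field_simp
      _ ≤ _ := by gcongr
  have h5 : Real.exp (-(b.re / 2 * ‖w‖ ^ 2)) =
      Real.exp (b.re / 2 * ‖w‖ ^ 2) * Real.exp (-(b.re * ‖w‖ ^ 2)) := by
    rw [← Real.exp_add]; congr 1; ring
  rw [h5, ← mul_assoc]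
  gcongr
  simpa using h4

lemma g1_int {b : ℂ} (hb : 0 < b.re) :
    Integrable (fun w : ℂ => w * Complex.exp (-b * (‖w‖:ℂ) ^ 2)) := by
  refine ((g0_int hb).norm.add (g2_int hb).norm).mono' (by fun_prop) ?_
  refine Filter.Eventually.of_forall fun w => ?_
  simp only [norm_mul, Pi.add_apply]
  have : ‖w‖ ≤ 1 + ‖w‖ ^ 2 := by nlinarith [sq_nonneg (‖w‖ - 1)]
  calc _ ≤ (1 + ‖w‖ ^ 2) * ‖Complex.exp (-b * (‖w‖:ℂ) ^ 2)‖ := by gcongr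
    _ = _ := by simp; ring

lemma g1_int' {b : ℂ} (hb : 0 < b.re) :
    Integrable (fun w : ℂ => (starRingEnd ℂ) w * Complex.exp (-b * (‖w‖:ℂ) ^ 2)) := by
  refine (g1_int hb).norm.mono' (by fun_prop) ?_
  exact Filter.Eventually.of_forall fun w => by simp

lemma odd_int (f : ℂ → ℂ) (h : ∀ w, f (-w) = - f w) : ∫ w, f w = 0 := by
  have h1 := integral_neg_eq_self f volume
  simp only [h, integral_neg] at h1
  linear_combination (-1/2 : ℂ) * h1

lemma g2_val {b : ℂ} (hb : 0 < b.re) :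
    ∫ w : ℂ, (‖w‖:ℂ) ^ 2 * Complex.exp (-b * (‖w‖:ℂ) ^ 2) = (Real.pi / b) * b⁻¹ := by
  have hb0 : b ≠ 0 := by rintro rfl; simp at hb
  have hi := g2_int hb
  rw [integrable_fun_norm_addHaar volume
    (f := fun y : ℝ => (y:ℂ) ^ 2 * Complex.exp (-b * (y:ℂ) ^ 2))] at hi
  rw [integral_fun_norm_addHaar volume
    (fun y : ℝ => (y:ℂ) ^ 2 * Complex.exp (-b * (y:ℂ) ^ 2))]
  simp only [Complex.finrank_real_complex] at hi ⊢
  have hd : ∀ x : ℝ, HasDerivAt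
      (fun y : ℝ => -((y:ℂ) ^ 2 / (2 * b) + 1 / (2 * b ^ 2)) * Complex.exp (-b * (y:ℂ) ^ 2))
      (x ^ (2 - 1) • ((x:ℂ) ^ 2 * Complex.exp (-b * (x:ℂ) ^ 2))) x := by
    intro x
    have : HasDerivAt
      (fun y : ℂ => -(y ^ 2 / (2 * b) + 1 / (2 * b ^ 2)) * Complex.exp (-b * y ^ 2))
      ((x:ℂ) * ((x:ℂ) ^ 2 * Complex.exp (-b * (x:ℂ) ^ 2))) x := by
      have h1 := (hasDerivAt_pow 2 (x:ℂ))
      convert! (((h1.div_const (2*b)).add_const (1 / (2 * b ^ 2))).neg).mul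
        ((h1.const_mul (-b)).cexp) using 1
      simp
      field_simp
      ring
    simpa using this.comp_ofReal
  have ht : Filter.Tendsto
      (fun y : ℝ => -((y:ℂ) ^ 2 / (2 * b) + 1 / (2 * b ^ 2)) * Complex.exp (-b * (y:ℂ) ^ 2))
      Filter.atTop (nhds 0) := by
    have hq : Filter.Tendsto (fun y : ℝ => b.re * y ^ 2) Filter.atTop Filter.atTop :=
      (Filter.tendsto_pow_atTop (by norm_num)).const_mul_atTop hb
    have e1 := (Real.tendsto_pow_mul_exp_neg_atTop_nhds_zero 1).comp hq
    have e0 := (Real.tendsto_pow_mul_exp_neg_atTop_nhds_zero 0).comp hq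
    have k0 : Filter.Tendsto (fun y : ℝ => Complex.exp (-b * (y:ℂ) ^ 2)) Filter.atTop (nhds 0) := by
      rw [tendsto_zero_iff_norm_tendsto_zero]
      simp only [g_norm]
      simpa [Function.comp_def] using e0
    have k1 : Filter.Tendsto (fun y : ℝ => (y:ℂ) ^ 2 * Complex.exp (-b * (y:ℂ) ^ 2))
        Filter.atTop (nhds 0) := by
      rw [tendsto_zero_iff_norm_tendsto_zero]
      simp only [norm_mul, g_norm]
      have := e1.const_mul (b.re)⁻¹
      simp only [mul_zero, Function.comp_def] at this
      refine this.congr fun y => ?_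
      simp
      field_simp
    have := (k1.const_mul (-(1 / (2 * b)))).add (k0.const_mul (-(1 / (2 * b ^ 2))))
    simp only [mul_zero, add_zero] at this
    refine this.congr fun y => ?_
    ring
  rw [integral_Ioi_of_hasDerivAt_of_tendsto (hd 0).continuousAt.continuousWithinAt
    (fun x _ => hd x) hi ht]
  simp [measureReal_def]
  field_simp

open scoped ComplexOrder MatrixOrder Matrix.Norms.L2Operator in
lemma simdiag {n : ℕ} (A : Matrix (Fin n) (Fin n) ℂ)
    (hA : ∀ z : Fin n → ℂ, z ≠ 0 → 0 < (star z ⬝ᵥ (A *ᵥ z)).re) :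
    ∃ (P : Matrix (Fin n) (Fin n) ℂ) (b : Fin n → ℂ), IsUnit P.det ∧ (∀ i, 0 < (b i).re) ∧
      Pᴴ * A * P = diagonal b := by
  set H : Matrix (Fin n) (Fin n) ℂ := (2⁻¹ : ℂ) • (A + Aᴴ) with hH
  set K : Matrix (Fin n) (Fin n) ℂ := (-Complex.I * 2⁻¹ : ℂ) • (A - Aᴴ) with hK
  have hAHK : A = H + Complex.I • K := by
    rw [hH, hK, smul_smul, ← mul_assoc]
    simp only [mul_neg, Complex.I_mul_I, neg_neg, one_mul]
    rw [← smul_add]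
    ext i j
    simp
    ring
  have hHh : H.IsHermitian := by
    rw [IsHermitian, hH, conjTranspose_smul, conjTranspose_add]
    simp [add_comm]
  have hKh : K.IsHermitian := by
    rw [IsHermitian, hK, conjTranspose_smul, conjTranspose_sub]
    ext i j
    simp
    ring
  have hp : H.PosDef := by
    refine .of_dotProduct_mulVec_pos hHh fun x hx => ?_
    have h1 : star x ⬝ᵥ (H *ᵥ x) = ((star x ⬝ᵥ (A *ᵥ x)).re : ℂ) := by
      have h2 : star x ⬝ᵥ (Aᴴ *ᵥ x) = star (star x ⬝ᵥ (A *ᵥ x)) := by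
        rw [star_dotProduct, star_mulVec, conjTranspose_conjTranspose,
          ← dotProduct_mulVec]
      rw [hH, smul_mulVec, add_mulVec, dotProduct_smul, dotProduct_add, h2, 
        Complex.re_eq_add_conj, smul_eq_mul]
      simp only [Complex.star_def]
      ring
    rw [h1]
    exact_mod_cast hA x hx
  obtain ⟨B, hB, hB'⟩ :=
    CStarAlgebra.isStrictlyPositive_iff_eq_star_mul_self.mp hp.isStrictlyPositive
  have hBd : IsUnit B.det := (isUnit_iff_isUnit_det B).mp hB
  have hK' : (B⁻¹ᴴ * K * B⁻¹).IsHermitian := isHermitian_conjTranspose_mul_mul _ hKh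
  have hs := hK'.spectral_theorem
  set U := hK'.eigenvectorUnitary
  set d := hK'.eigenvalues
  have hU : (U : Matrix (Fin n) (Fin n) ℂ)ᴴ * U = 1 := Unitary.coe_star_mul_self U
  rw [Unitary.conjStarAlgAut_apply] at hs
  refine ⟨B⁻¹ * U, fun i => 1 + Complex.I * d i, ?_, ?_, ?_⟩
  · rw [det_mul]
    refine IsUnit.mul (isUnit_nonsing_inv_det _ hBd) ?_
    have := congrArg det hU
    rw [det_mul, det_one] at this
    exact IsUnit.of_mul_eq_one_right _ this
  · intro i; simp
  · have e1 : B⁻¹ᴴ * H * B⁻¹ = 1 := by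
      rw [hB', star_eq_conjTranspose, ← mul_assoc, ← conjTranspose_mul, mul_nonsing_inv _ hBd,
        conjTranspose_one, one_mul, mul_nonsing_inv _ hBd]
    have e2 : (B⁻¹ * U : Matrix (Fin n) (Fin n) ℂ)ᴴ * A * (B⁻¹ * U) =
        (U : Matrix (Fin n) (Fin n) ℂ)ᴴ * (B⁻¹ᴴ * H * B⁻¹) * U +
        Complex.I • ((U : Matrix (Fin n) (Fin n) ℂ)ᴴ * (B⁻¹ᴴ * K * B⁻¹) * U) := by
      rw [hAHK, conjTranspose_mul]
      simp only [mul_add, add_mul, smul_mul, mul_assoc, Matrix.mul_smul, Matrix.smul_mul]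
    rw [e2, e1, hs, mul_one, hU]
    have e3 : ∀ D : Matrix (Fin n) (Fin n) ℂ, (U : Matrix (Fin n) (Fin n) ℂ)ᴴ *
        ((U : Matrix (Fin n) (Fin n) ℂ) * D * star (U : Matrix (Fin n) (Fin n) ℂ)) * U = D := by
      intro D
      rw [star_eq_conjTranspose]
      calc _ = ((U : Matrix (Fin n) (Fin n) ℂ)ᴴ * U) * D * ((U : Matrix (Fin n) (Fin n) ℂ)ᴴ * U) := by
            simp only [mul_assoc]
        _ = D := by rw [hU, one_mul, mul_one]
    rw [e3]
    ext i j
    by_cases hij : i = j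
    · subst hij; simp
    · simp [hij]

lemma cov {n : ℕ} (P : Matrix (Fin n) (Fin n) ℂ) (hP : IsUnit P.det) (f : (Fin n → ℂ) → ℂ)
    (hf : Integrable (fun w => f (P *ᵥ w))) :
    Integrable f ∧ ∫ z, f z = (P.det * star P.det) * ∫ w, f (P *ᵥ w) := by
  set L : (Fin n → ℂ) →ₗ[ℝ] (Fin n → ℂ) := (Matrix.toLin' P).restrictScalars ℝ with hL
  have hdet : L.det = Complex.normSq P.det := by
    rw [hL, LinearMap.det_restrictScalars, LinearMap.det_toLin', Algebra.norm_complex_apply]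
  have hd0 : Complex.normSq P.det ≠ 0 := by
    simpa using hP.ne_zero
  have hL0 : L.det ≠ 0 := by rwa [hdet]
  have hmap := Measure.map_linearMap_addHaar_eq_smul_addHaar (μ := volume) hL0
  have hemb : MeasurableEmbedding L :=
    ((LinearMap.equivOfDetNeZero L hL0).toContinuousLinearEquiv.toHomeomorph).measurableEmbedding
  have hLa : ∀ w, L w = P *ᵥ w := fun w => rfl
  have hi : Integrable f (Measure.map L volume) := by
    rw [hemb.integrable_map_iff]; exact hf
  have hc : ENNReal.ofReal |(L.det)⁻¹| ≠ 0 := by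
    simpa using hL0
  rw [hmap, integrable_smul_measure hc ENNReal.ofReal_ne_top] at hi
  refine ⟨hi, ?_⟩
  have h := hemb.integral_map (μ := volume) f
  rw [hmap, integral_smul_measure, hdet, ENNReal.toReal_ofReal (abs_nonneg _),
    abs_of_nonneg (inv_nonneg.mpr (Complex.normSq_nonneg _))] at h
  simp only [hLa] at h
  rw [← h]
  have : P.det * star P.det = (Complex.normSq P.det : ℂ) := Complex.mul_conj _
  rw [this, Complex.real_smul, ← mul_assoc, ← Complex.ofReal_mul, mul_inv_cancel₀ hd0]
  simp

lemma diag0 {n : ℕ} (b : Fin n → ℂ) (hb : ∀ i, 0 < (b i).re) :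
    Integrable (fun w : Fin n → ℂ => Complex.exp (-∑ i, b i * (‖w i‖:ℂ) ^ 2)) ∧
    ∫ w : Fin n → ℂ, Complex.exp (-∑ i, b i * (‖w i‖:ℂ) ^ 2) = ∏ i, (Real.pi / b i) := by
  have h : ∀ w : Fin n → ℂ, Complex.exp (-∑ i, b i * (‖w i‖:ℂ) ^ 2) =
      ∏ i, Complex.exp (- b i * (‖w i‖:ℂ) ^ 2) := by
    intro w
    rw [← Complex.exp_sum, ← Finset.sum_neg_distrib]; simp
  simp only [h]
  refine ⟨Integrable.fintype_prod (f := fun i x => Complex.exp (- b i * (‖x‖:ℂ) ^ 2))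
    fun i => g0_int (hb i), ?_⟩
  rw [integral_fintype_prod_volume_eq_prod (f := fun i x => Complex.exp (- b i * (‖x‖:ℂ) ^ 2))]
  exact Finset.prod_congr rfl fun i _ => g0_val (hb i)

lemma diag2 {n : ℕ} (b : Fin n → ℂ) (hb : ∀ i, 0 < (b i).re) (a c : Fin n) :
    Integrable (fun w : Fin n → ℂ =>
      (starRingEnd ℂ) (w c) * w a * Complex.exp (-∑ i, b i * (‖w i‖:ℂ) ^ 2)) ∧
    ∫ w : Fin n → ℂ, (starRingEnd ℂ) (w c) * w a * Complex.exp (-∑ i, b i * (‖w i‖:ℂ) ^ 2) =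
      (∏ i, (Real.pi / b i)) * (if a = c then (b a)⁻¹ else 0) := by
  set f : Fin n → ℂ → ℂ := fun i x => (if i = c then (starRingEnd ℂ) x else 1) *
    (if i = a then x else 1) * Complex.exp (- b i * (‖x‖:ℂ) ^ 2) with hf
  have h : ∀ w : Fin n → ℂ, (starRingEnd ℂ) (w c) * w a *
      Complex.exp (-∑ i, b i * (‖w i‖:ℂ) ^ 2) = ∏ i, f i (w i) := by
    intro w
    simp only [hf, Finset.prod_mul_distrib, ← Complex.exp_sum, ← Finset.sum_neg_distrib]
    simp
  have hcm : ∀ x : ℂ, (starRingEnd ℂ) x * x = (‖x‖:ℂ) ^ 2 := fun x => Complex.conj_mul' x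
  simp only [h]
  constructor
  · refine Integrable.fintype_prod (f := f) fun i => ?_
    simp only [hf]
    split_ifs <;> simp only [one_mul, mul_one, hcm]
    · exact g2_int (hb _)
    · exact g1_int' (hb _)
    · exact g1_int (hb _)
    · exact g0_int (hb _)
  rw [integral_fintype_prod_volume_eq_prod (f := f)]
  by_cases hac : a = c
  · subst hac
    have : ∀ i, ∫ x, f i x = (Real.pi / b i) * (if i = a then (b a)⁻¹ else 1) := by
      intro i
      by_cases h1 : i = a
      · subst h1
        simp only [hf, if_true, hcm]
        exact g2_val (hb _)
      · simp only [hf, h1, if_false, one_mul, mul_one]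
        exact g0_val (hb _)
    simp only [this, Finset.prod_mul_distrib]
    simp
  · rw [Finset.prod_eq_zero (Finset.mem_univ a)]
    · simp [hac]
    · apply odd_int
      intro w
      simp [hf, hac]

/-- complex Gaussian integral formulas. For `A ∈ ℂ^{n×n}` with
positive definite Hermitian part: both Gaussian integrals converge absolutely,
`π⁻ⁿ ∫ e^{-⟨z,Az⟩} dz = 1/det A`, and
`(A⁻¹)_{jk} = det A · π⁻ⁿ ∫ conj(z_k) z_j e^{-⟨z,Az⟩} dz`. -/
theorem complex_gaussian_integrals (n : ℕ) (hn : 1 ≤ n)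
    (A : Matrix (Fin n) (Fin n) ℂ)
    (hA : ∀ z : Fin n → ℂ, z ≠ 0 → 0 < (star z ⬝ᵥ (A *ᵥ z)).re) :
    Integrable (fun z : Fin n → ℂ => Complex.exp (-(star z ⬝ᵥ (A *ᵥ z)))) ∧
    (∀ j k : Fin n,
      Integrable (fun z : Fin n → ℂ =>
        (starRingEnd ℂ) (z k) * z j * Complex.exp (-(star z ⬝ᵥ (A *ᵥ z))))) ∧
    (((Real.pi : ℂ) ^ n)⁻¹ *
        ∫ z : Fin n → ℂ, Complex.exp (-(star z ⬝ᵥ (A *ᵥ z))) = 1 / A.det) ∧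
    (∀ j k : Fin n,
      A⁻¹ j k = A.det * ((Real.pi : ℂ) ^ n)⁻¹ *
        ∫ z : Fin n → ℂ,
          (starRingEnd ℂ) (z k) * z j * Complex.exp (-(star z ⬝ᵥ (A *ᵥ z)))) := by
  obtain ⟨P, b, hP, hb, hD⟩ := simdiag A hA
  have hQ : ∀ w : Fin n → ℂ, star (P *ᵥ w) ⬝ᵥ (A *ᵥ (P *ᵥ w)) =
      ∑ i, b i * (‖w i‖:ℂ) ^ 2 := by
    intro w
    have : star (P *ᵥ w) ⬝ᵥ (A *ᵥ (P *ᵥ w)) = star w ⬝ᵥ ((Pᴴ * A * P) *ᵥ w) := by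
      rw [star_mulVec, ← dotProduct_mulVec, mulVec_mulVec, mulVec_mulVec]
    rw [this, hD]
    simp only [dotProduct, mulVec_diagonal, Pi.star_apply]
    refine Finset.sum_congr rfl fun i _ => ?_
    rw [← Complex.conj_mul']
    simp only [Complex.star_def]
    ring
  have hdetD : star P.det * A.det * P.det = ∏ i, b i := by
    rw [← det_diagonal, ← hD, det_mul, det_mul, det_conjTranspose]
  have hb0 : ∀ i, b i ≠ 0 := fun i h => by have := hb i; simp [h] at this
  have hprod : ∏ i, b i ≠ 0 := Finset.prod_ne_zero_iff.mpr fun i _ => hb0 i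
  have hA0 : A.det ≠ 0 := by
    intro h; rw [h] at hdetD; simp at hdetD; exact hprod hdetD.symm
  have hpi : ((Real.pi : ℂ) ^ n) ≠ 0 := pow_ne_zero _ (by exact_mod_cast Real.pi_ne_zero)
  have hpp : ∏ i, ((Real.pi : ℂ) / b i) = (Real.pi : ℂ) ^ n / ∏ i, b i := by
    simp [Finset.prod_div_distrib]
  have key : P.det * star P.det * ∏ i, ((Real.pi : ℂ) / b i) = (Real.pi : ℂ) ^ n / A.det := by
    rw [hpp, ← hdetD]
    have h1 := hP.ne_zero
    have h2 : star P.det ≠ 0 := star_ne_zero.mpr h1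
    field_simp
  have c0 := cov P hP (fun z : Fin n → ℂ => Complex.exp (-(star z ⬝ᵥ (A *ᵥ z))))
    (by simp only [hQ]; exact (diag0 b hb).1)
  have hexp : ∀ (j k : Fin n) (w : Fin n → ℂ), (starRingEnd ℂ) ((P *ᵥ w) k) * (P *ᵥ w) j *
      Complex.exp (-∑ i, b i * (‖w i‖:ℂ) ^ 2) =
      ∑ a, ∑ c, (P j a * star (P k c)) * ((starRingEnd ℂ) (w c) * w a *
        Complex.exp (-∑ i, b i * (‖w i‖:ℂ) ^ 2)) := by
    intro j k w
    simp only [mulVec, dotProduct, map_sum, map_mul]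
    rw [mul_comm (∑ i, (starRingEnd ℂ) (P k i) * (starRingEnd ℂ) (w i)), Finset.sum_mul_sum,
      Finset.sum_mul]
    refine Finset.sum_congr rfl fun a _ => ?_
    rw [Finset.sum_mul]
    refine Finset.sum_congr rfl fun c _ => ?_
    simp only [Complex.star_def]
    ring
  have hint : ∀ j k a c : Fin n, Integrable (fun w : Fin n → ℂ => (P j a * star (P k c)) *
      ((starRingEnd ℂ) (w c) * w a * Complex.exp (-∑ i, b i * (‖w i‖:ℂ) ^ 2))) :=
    fun j k a c => (diag2 b hb a c).1.const_mul _
  have c2 : ∀ j k : Fin n, _ := fun j k => cov P hP (fun z : Fin n → ℂ =>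
        (starRingEnd ℂ) (z k) * z j * Complex.exp (-(star z ⬝ᵥ (A *ᵥ z))))
    (by
      simp only [hQ, hexp]
      exact integrable_finsetSum _ fun a _ => integrable_finsetSum _ fun c _ => hint j k a c)
  refine ⟨c0.1, fun j k => (c2 j k).1, ?_, fun j k => ?_⟩
  · rw [c0.2]
    simp only [hQ]
    rw [(diag0 b hb).2, key]
    field_simp
  · rw [(c2 j k).2]
    simp only [hQ, hexp]
    rw [integral_finsetSum _ fun a _ => integrable_finsetSum _ fun c _ => hint j k a c]
    have hs : ∀ a, ∫ w : Fin n → ℂ, ∑ c, (P j a * star (P k c)) * ((starRingEnd ℂ) (w c) * w a *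
        Complex.exp (-∑ i, b i * (‖w i‖:ℂ) ^ 2)) =
        (∏ i, ((Real.pi : ℂ) / b i)) * (P j a * (b a)⁻¹ * star (P k a)) := by
      intro a
      rw [integral_finsetSum _ fun c _ => hint j k a c]
      simp only [integral_const_mul, (diag2 b hb _ _).2]
      simp
      ring
    simp only [hs]
    rw [← Finset.mul_sum]
    have hinv : A⁻¹ = P * diagonal (fun i => (b i)⁻¹) * Pᴴ := by
      have hPu : IsUnit Pᴴ.det := by rw [det_conjTranspose]; exact hP.star
      have hAe : A = Pᴴ⁻¹ * diagonal b * P⁻¹ := by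
        rw [← hD]
        rw [mul_assoc, mul_assoc, mul_assoc, mul_nonsing_inv _ hP, mul_one, ← mul_assoc,
          nonsing_inv_mul _ hPu, one_mul]
      apply inv_eq_right_inv
      rw [hAe]
      calc _ = Pᴴ⁻¹ * (diagonal b * (P⁻¹ * P) * diagonal (fun i => (b i)⁻¹)) * Pᴴ := by
            simp only [mul_assoc]
        _ = 1 := by
          rw [nonsing_inv_mul _ hP, mul_one, diagonal_mul_diagonal]
          simp [hb0, nonsing_inv_mul _ hPu]
    have hA1 : A⁻¹ j k = ∑ a, P j a * (b a)⁻¹ * star (P k a) := by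
      rw [hinv, mul_apply]
      simp [mul_diagonal]
    rw [hA1, ← mul_assoc, ← mul_assoc, mul_assoc _ (P.det * star P.det), key]
    field_simp
end
end

section
/- Gaussian integral with linear source and quadratic observable: let m ≥ 1, B ∈ ℂ^{m×m} with positive definite Hermitian part (Re ⟨w, Bw⟩ > 0 for w ≠ 0), a ∈ ℂ^m, and c ∈ ℂ. Then det B · π^{−m} ∫_{ℂ^m} ( ‖w‖² + c ) e^{ −⟨w, Bw⟩ − i⟨w, a⟩ − i⟨a, w⟩ } dm(w) = e^{ −⟨a, B^{−1} a⟩ } ( Tr B^{−1} − ⟨a, B^{−2} a⟩ + c ). -/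
open MeasureTheory Matrix

noncomputable section

def gg (d : ℂ) (s : ℝ) (x : ℝ) : ℂ := Complex.exp (-d * x ^ 2 + (-2 * Complex.I * s) * x + 0)

lemma gg_pow_integrable {d : ℂ} (hd : 0 < d.re) (s : ℝ) (n : ℕ) :
    Integrable (fun x : ℝ => (x : ℂ) ^ n * gg d s x) := by
  have h1 := (integrable_cexp_quadratic hd (-2 * Complex.I * s + 1) 0).norm
  have h2 := (integrable_cexp_quadratic hd (-2 * Complex.I * s - 1) 0).norm
  refine Integrable.mono' ((h1.add h2).const_mul (n.factorial : ℝ)) ?_ ?_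
  · unfold gg
    exact Continuous.aestronglyMeasurable (by fun_prop)
  · refine Filter.Eventually.of_forall fun x => ?_
    have e1 : Complex.exp (-d * x ^ 2 + (-2 * Complex.I * s + 1) * x + 0) =
        gg d s x * Complex.exp x := by
      unfold gg; rw [← Complex.exp_add]; ring_nf
    have e2 : Complex.exp (-d * x ^ 2 + (-2 * Complex.I * s - 1) * x + 0) =
        gg d s x * Complex.exp (-x) := by
      unfold gg; rw [← Complex.exp_add]; ring_nf
    simp only [Pi.add_apply]
    rw [e1, e2, norm_mul, norm_mul, norm_mul, norm_pow, Complex.norm_exp, Complex.norm_exp,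
      Complex.norm_real, Real.norm_eq_abs]
    simp only [Complex.ofReal_re, Complex.neg_re]
    have h3 : |x| ^ n ≤ n.factorial * Real.exp |x| := by
      have := Real.pow_div_factorial_le_exp |x| (abs_nonneg x) n
      rw [div_le_iff₀ (by positivity)] at this
      linarith
    have h4 : Real.exp |x| ≤ Real.exp x + Real.exp (-x) := by
      rcases abs_cases x with h | h <;> rw [h.1] <;> linarith [Real.exp_pos x, Real.exp_pos (-x)]
    have h5 : |x| ^ n ≤ n.factorial * (Real.exp x + Real.exp (-x)) :=
      h3.trans (by gcongr)
    calc _ ≤ (n.factorial * (Real.exp x + Real.exp (-x))) * ‖gg d s x‖ := by gcongr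
      _ = _ := by ring

lemma gg_hasDerivAt (d : ℂ) (s : ℝ) (x : ℝ) :
    HasDerivAt (gg d s) ((-2 * d * x - 2 * Complex.I * s) * gg d s x) x := by
  have h : HasDerivAt (fun z : ℂ => Complex.exp (-d * z ^ 2 + (-2 * Complex.I * s) * z + 0))
      ((-2 * d * x - 2 * Complex.I * s) * gg d s x) (x : ℂ) := by
    have := (((((hasDerivAt_id (x : ℂ)).pow 2).const_mul (-d)).add
      ((hasDerivAt_id (x : ℂ)).const_mul (-2 * Complex.I * s))).add_const 0).cexp
    convert! this using 1
    simp [gg]; ring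
  exact h.comp_ofReal

lemma gg_m1 {d : ℂ} (hd : 0 < d.re) (s : ℝ) :
    ∫ x : ℝ, (x : ℂ) ^ 1 * gg d s x = (-Complex.I * s / d) * ∫ x : ℝ, (x : ℂ) ^ 0 * gg d s x := by
  have hd0 : d ≠ 0 := by rintro rfl; simp at hd
  have i0 := gg_pow_integrable hd s 0
  have i1 := gg_pow_integrable hd s 1
  have e : (fun x : ℝ => (-2 * d * x - 2 * Complex.I * s) * gg d s x) =
      fun x : ℝ => (-2 * d) * ((x : ℂ) ^ 1 * gg d s x) - (2 * Complex.I * s) * ((x : ℂ) ^ 0 * gg d s x) := by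
    ext x; ring
  have := integral_eq_zero_of_hasDerivAt_of_integrable (gg_hasDerivAt d s)
    (by rw [e]; exact (i1.const_mul _).sub (i0.const_mul _)) (by simpa using i0)
  rw [e, integral_sub (i1.const_mul _) (i0.const_mul _), integral_const_mul, integral_const_mul] at this
  generalize (∫ x : ℝ, (x : ℂ) ^ 0 * gg d s x) = M0 at *
  generalize (∫ x : ℝ, (x : ℂ) ^ 1 * gg d s x) = M1 at *
  field_simp
  linear_combination (-1/2) * this

lemma gg_m2 {d : ℂ} (hd : 0 < d.re) (s : ℝ) :
    ∫ x : ℝ, (x : ℂ) ^ 2 * gg d s x =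
      (1 / (2 * d) - s ^ 2 / d ^ 2) * ∫ x : ℝ, (x : ℂ) ^ 0 * gg d s x := by
  have hd0 : d ≠ 0 := by rintro rfl; simp at hd
  have i0 := gg_pow_integrable hd s 0
  have i1 := gg_pow_integrable hd s 1
  have i2 := gg_pow_integrable hd s 2
  have e : (fun x : ℝ => 1 * gg d s x + (x : ℂ) * ((-2 * d * x - 2 * Complex.I * s) * gg d s x)) =
      fun x : ℝ => (-2 * d) * ((x : ℂ) ^ 2 * gg d s x) + (-(2 * Complex.I * s) * ((x : ℂ) ^ 1 * gg d s x)
        + (x : ℂ) ^ 0 * gg d s x) := by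
    ext x; ring
  have := integral_eq_zero_of_hasDerivAt_of_integrable
    (fun x : ℝ => ((hasDerivAt_id (x : ℂ)).comp_ofReal).mul (gg_hasDerivAt d s x))
    (by simp only [id]; rw [e]; exact (i2.const_mul _).add ((i1.const_mul _).add i0)) (by simpa using! i1)
  simp only [id] at this
  have i3 : Integrable (fun x : ℝ => -(2 * Complex.I * s) * ((x : ℂ) ^ 1 * gg d s x)
        + (x : ℂ) ^ 0 * gg d s x) := (i1.const_mul _).add i0
  rw [e, integral_add (i2.const_mul _) i3,
    integral_add (i1.const_mul _) i0, integral_const_mul, integral_const_mul, gg_m1 hd] at this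
  generalize (∫ x : ℝ, (x : ℂ) ^ 0 * gg d s x) = M0 at *
  generalize (∫ x : ℝ, (x : ℂ) ^ 2 * gg d s x) = M2 at *
  field_simp at this ⊢
  linear_combination (-1) * this + 2 * s ^ 2 * M0 * Complex.I_sq

lemma gg_m0 {d : ℂ} (hd : 0 < d.re) (s : ℝ) :
    ∫ x : ℝ, (x : ℂ) ^ 0 * gg d s x = (Real.pi / d) ^ (1 / 2 : ℂ) * Complex.exp (- s ^ 2 / d) := by
  have hd0 : d ≠ 0 := by rintro rfl; simp at hd
  have := integral_cexp_quadratic (b := -d) (by simpa using hd) (-2 * Complex.I * s) 0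
  simp only [pow_zero, one_mul]
  unfold gg
  rw [this, neg_neg]
  congr 2
  field_simp
  linear_combination (4 * (s : ℂ) ^ 2) * Complex.I_sq

lemma complex_prod {u v : ℝ → ℂ} (hu : Integrable u) (hv : Integrable v) :
    Integrable (fun z : ℂ => u z.re * v z.im) ∧
    ∫ z : ℂ, u z.re * v z.im = (∫ x, u x) * ∫ y, v y := by
  have hp := Complex.volume_preserving_equiv_real_prod
  constructor
  · have := (hu.mul_prod hv)
    exact (hp.integrable_comp_emb (Complex.measurableEquivRealProd.measurableEmbedding)).2 this
  · rw [← integral_prod_mul]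
    exact hp.integral_comp (Complex.measurableEquivRealProd.measurableEmbedding)
      (fun p : ℝ × ℝ => u p.1 * v p.2)

def EE (d b z : ℂ) : ℂ :=
  Complex.exp (-(d * (star z * z)) - Complex.I * (star z * b) - Complex.I * (star b * z))

lemma EE_eq (d b z : ℂ) : EE d b z = gg d b.re z.re * gg d b.im z.im := by
  unfold EE gg
  rw [← Complex.exp_add]
  congr 1
  obtain ⟨x, y⟩ := z
  obtain ⟨s, t⟩ := b
  simp only [Complex.mk_eq_add_mul_I, Complex.star_def, map_add, map_mul, Complex.conj_ofReal,
    Complex.conj_I]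
  simp
  linear_combination (d * y ^ 2 + 2 * Complex.I * y * t) * Complex.I_sq

def ZZ (d b : ℂ) : ℂ := Real.pi / d * Complex.exp (-(star b * b) / d)

lemma EE_moments {d : ℂ} (hd : 0 < d.re) (b : ℂ) :
    (Integrable (fun z => EE d b z) ∧ ∫ z, EE d b z = ZZ d b) ∧
    (Integrable (fun z => star z * EE d b z) ∧
      ∫ z, star z * EE d b z = (-Complex.I * star b / d) * ZZ d b) ∧
    (Integrable (fun z => z * EE d b z) ∧
      ∫ z, z * EE d b z = (-Complex.I * b / d) * ZZ d b) ∧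
    (Integrable (fun z => star z * z * EE d b z) ∧
      ∫ z, star z * z * EE d b z = (1 / d - star b * b / d ^ 2) * ZZ d b) := by
  have hd0 : d ≠ 0 := by rintro rfl; simp at hd
  have I := fun (j k : ℕ) => complex_prod (gg_pow_integrable hd b.re j) (gg_pow_integrable hd b.im k)
  have hsb : star b * b = (b.re : ℂ) ^ 2 + (b.im : ℂ) ^ 2 := by
    rw [Complex.star_def, Complex.conj_mul', ← Complex.ofReal_pow, ← Complex.normSq_eq_norm_sq,
      Complex.normSq_apply]; push_cast; ring
  have hz : (∫ x : ℝ, (x : ℂ) ^ 0 * gg d b.re x) * (∫ x : ℝ, (x : ℂ) ^ 0 * gg d b.im x) = ZZ d b := by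
    rw [gg_m0 hd, gg_m0 hd, ZZ, hsb]
    have : ((Real.pi : ℂ) / d) ^ (1 / 2 : ℂ) * ((Real.pi : ℂ) / d) ^ (1 / 2 : ℂ) = Real.pi / d := by
      rw [← Complex.cpow_add _ _ (div_ne_zero (by simp [Real.pi_ne_zero]) hd0)]
      norm_num
    rw [mul_mul_mul_comm, this, ← Complex.exp_add]
    congr 2; ring
  have hb : b = b.re + b.im * Complex.I := (Complex.re_add_im b).symm
  have hb' : star b = b.re - b.im * Complex.I := by
    apply Complex.ext <;> simp
  have zz : ∀ z : ℂ, z = z.re + z.im * Complex.I := fun z => (Complex.re_add_im z).symm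
  have zz' : ∀ z : ℂ, star z = z.re - z.im * Complex.I := fun z => by
    apply Complex.ext <;> simp
  have e0 : (fun z => EE d b z) = fun z : ℂ => (z.re : ℂ) ^ 0 * gg d b.re z.re *
      ((z.im : ℂ) ^ 0 * gg d b.im z.im) := by
    ext z; rw [EE_eq]; ring
  have e1 : (fun z => star z * EE d b z) = fun z : ℂ => (z.re : ℂ) ^ 1 * gg d b.re z.re *
      ((z.im : ℂ) ^ 0 * gg d b.im z.im) + (- Complex.I) * ((z.re : ℂ) ^ 0 * gg d b.re z.re *
      ((z.im : ℂ) ^ 1 * gg d b.im z.im)) := by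
    ext z; rw [EE_eq, zz' z]; ring
  have e2 : (fun z => z * EE d b z) = fun z : ℂ => (z.re : ℂ) ^ 1 * gg d b.re z.re *
      ((z.im : ℂ) ^ 0 * gg d b.im z.im) + (Complex.I) * ((z.re : ℂ) ^ 0 * gg d b.re z.re *
      ((z.im : ℂ) ^ 1 * gg d b.im z.im)) := by
    ext z; rw [EE_eq]; nth_rw 1 [zz z]; ring
  have e3 : (fun z => star z * z * EE d b z) = fun z : ℂ => (z.re : ℂ) ^ 2 * gg d b.re z.re *
      ((z.im : ℂ) ^ 0 * gg d b.im z.im) + ((z.re : ℂ) ^ 0 * gg d b.re z.re *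
      ((z.im : ℂ) ^ 2 * gg d b.im z.im)) := by
    ext z; rw [EE_eq, zz' z]; nth_rw 3 [zz z]
    linear_combination (-(z.im : ℂ) ^ 2 * gg d b.re z.re * gg d b.im z.im) * Complex.I_sq
  refine ⟨⟨?_, ?_⟩, ⟨?_, ?_⟩, ⟨?_, ?_⟩, ⟨?_, ?_⟩⟩
  · rw [e0]; exact (I 0 0).1
  · rw [e0, (I 0 0).2, hz]
  · rw [e1]; exact (I 1 0).1.add ((I 0 1).1.const_mul _)
  · rw [e1, integral_add (I 1 0).1 ((I 0 1).1.const_mul _), integral_const_mul, (I 1 0).2,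
      (I 0 1).2, gg_m1 hd, gg_m1 hd, hb', ← hz]
    ring
  · rw [e2]; exact (I 1 0).1.add ((I 0 1).1.const_mul _)
  · rw [e2, integral_add (I 1 0).1 ((I 0 1).1.const_mul _), integral_const_mul, (I 1 0).2,
      (I 0 1).2, gg_m1 hd, gg_m1 hd, ← hz]
    generalize (∫ x : ℝ, (x : ℂ) ^ 0 * gg d b.re x) = M0
    generalize (∫ x : ℝ, (x : ℂ) ^ 0 * gg d b.im x) = M1
    linear_combination Complex.I / d * M0 * M1 * hb
  · rw [e3]; exact (I 2 0).1.add (I 0 2).1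
  · rw [e3, integral_add (I 2 0).1 (I 0 2).1, (I 2 0).2,
      (I 0 2).2, gg_m2 hd, gg_m2 hd, ← hz, hsb]
    field_simp
    ring

lemma cov_s12 {m : ℕ} (Q : Matrix (Fin m) (Fin m) ℂ) (hQ : Q.det ≠ 0) (f : (Fin m → ℂ) → ℂ) :
    ∫ w, f w = (star Q.det * Q.det) * ∫ v, f (Q *ᵥ v) := by
  let L : (Fin m → ℂ) →ₗ[ℝ] (Fin m → ℂ) := (Matrix.toLin' Q).restrictScalars ℝ
  have hdet : LinearMap.det L = Complex.normSq Q.det := by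
    rw [LinearMap.det_restrictScalars, LinearMap.det_toLin', Algebra.norm_complex_apply]
  have hdet0 : LinearMap.det L ≠ 0 := by
    rw [hdet]; simpa using hQ
  have hmap := Measure.map_linearMap_addHaar_eq_smul_addHaar (volume : Measure (Fin m → ℂ)) hdet0
  have he : MeasurableEmbedding L :=
    ((LinearEquiv.ofIsUnitDet (f := L) (v := Module.finBasis ℝ _) (v' := Module.finBasis ℝ _)
      (by simpa using hdet0)).toContinuousLinearEquiv.toHomeomorph.measurableEmbedding)
  have h2 : ∫ v, f (Q *ᵥ v) = ∫ w, f w ∂(Measure.map L volume) := by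
    rw [he.integral_map]; rfl
  rw [h2, hmap, integral_smul_measure, hdet, ENNReal.toReal_ofReal (abs_nonneg _),
    Complex.star_def, ← Complex.normSq_eq_conj_mul_self, abs_of_nonneg (by simp [Complex.normSq_nonneg]), Complex.real_smul]
  rw [← mul_assoc, Complex.ofReal_inv, mul_inv_cancel₀, one_mul]
  simpa using hQ

open scoped ComplexOrder MatrixOrder in
lemma decomp {m : ℕ} (B : Matrix (Fin m) (Fin m) ℂ)
    (hB : ∀ w : Fin m → ℂ, w ≠ 0 → 0 < (star w ⬝ᵥ (B *ᵥ w)).re) :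
    ∃ (Q : Matrix (Fin m) (Fin m) ℂ) (d : Fin m → ℂ), Q.det ≠ 0 ∧ (∀ i, 0 < (d i).re) ∧
      Qᴴ * B * Q = diagonal d := by
  set H : Matrix (Fin m) (Fin m) ℂ := (1 / 2 : ℂ) • (B + Bᴴ) with hH
  set K : Matrix (Fin m) (Fin m) ℂ := (-Complex.I / 2 : ℂ) • (B - Bᴴ) with hK
  have hBHK : B = H + Complex.I • K := by
    rw [hH, hK, smul_smul]
    ext i j
    simp
    linear_combination ((B i j - (starRingEnd ℂ) (B j i)) / 2) * Complex.I_sq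
  have hHh : H.IsHermitian := by
    ext i j; simp [hH]; ring
  have hKh : K.IsHermitian := by
    ext i j; simp [hK]; ring
  have hHp : H.PosDef := by
    refine Matrix.PosDef.of_dotProduct_mulVec_pos hHh fun x hx => ?_
    have h1 := hB x hx
    have h2 : star x ⬝ᵥ (Bᴴ *ᵥ x) = star (star x ⬝ᵥ (B *ᵥ x)) := by
      rw [star_dotProduct, star_mulVec, conjTranspose_conjTranspose, ← dotProduct_mulVec]
    have h3 : star x ⬝ᵥ (H *ᵥ x) = ((star x ⬝ᵥ (B *ᵥ x)).re : ℂ) := by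
      rw [hH, smul_mulVec, dotProduct_smul, add_mulVec, dotProduct_add, h2, Complex.star_def,
        Complex.add_conj]
      simp
    rw [h3]
    exact_mod_cast h1
  obtain ⟨S, hS⟩ : ∃ S : Matrix (Fin m) (Fin m) ℂ, H = Sᴴ * S := by
    have := hHp.posSemidef
    exact CStarAlgebra.nonneg_iff_eq_star_mul_self.1 this.nonneg
  have hSd : S.det ≠ 0 := by
    intro h
    have := hHp.det_pos
    rw [hS, det_mul, h, mul_zero] at this
    exact lt_irrefl _ this
  have hSu : IsUnit S.det := isUnit_iff_ne_zero.2 hSd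
  have hM : ((S⁻¹)ᴴ * K * S⁻¹).IsHermitian := by
    exact isHermitian_conjTranspose_mul_mul _ hKh
  set U : Matrix (Fin m) (Fin m) ℂ := (hM.eigenvectorUnitary : Matrix (Fin m) (Fin m) ℂ) with hU
  have hUU : Uᴴ * U = 1 := by
    exact Unitary.coe_star_mul_self hM.eigenvectorUnitary
  have hsp : Uᴴ * ((S⁻¹)ᴴ * K * S⁻¹) * U = diagonal (fun i => (hM.eigenvalues i : ℂ)) := by
    have := hM.spectral_theorem
    rw [Unitary.conjStarAlgAut_apply] at this
    refine (congrArg (fun X => Uᴴ * X * U) this).trans ?_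
    change Uᴴ * (U * diagonal (fun i => (hM.eigenvalues i : ℂ)) * Uᴴ) * U = _
    calc _ = (Uᴴ * U) * diagonal (fun i => (hM.eigenvalues i : ℂ)) * (Uᴴ * U) := by
            simp only [Matrix.mul_assoc]
      _ = _ := by rw [hUU]; simp
  refine ⟨S⁻¹ * U, fun i => 1 + Complex.I * hM.eigenvalues i, ?_, ?_, ?_⟩
  · have : U.det ≠ 0 := by
      intro h
      have := congrArg det hUU
      simp [h] at this
    rw [det_mul]
    refine mul_ne_zero ?_ this
    simpa [Matrix.det_nonsing_inv] using hSd
  · intro i; simp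
  · have hH1 : (S⁻¹)ᴴ * H * S⁻¹ = 1 := by
      rw [hS]
      calc _ = (S * S⁻¹)ᴴ * (S * S⁻¹) := by simp only [conjTranspose_mul, Matrix.mul_assoc]
        _ = 1 := by rw [Matrix.mul_nonsing_inv _ hSu]; simp
    have : (S⁻¹ * U)ᴴ * B * (S⁻¹ * U) = Uᴴ * ((S⁻¹)ᴴ * H * S⁻¹) * U +
        Complex.I • (Uᴴ * ((S⁻¹)ᴴ * K * S⁻¹) * U) := by
      rw [hBHK]
      simp only [conjTranspose_mul, Matrix.mul_assoc, Matrix.mul_add, Matrix.add_mul,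
        Matrix.mul_smul, Matrix.smul_mul]
    rw [this, hH1, hsp, Matrix.mul_one, hUU]
    ext i j
    by_cases h : i = j
    · subst h; simp
    · simp [h]

lemma EP_zero {m : ℕ} {d : Fin m → ℂ} (hd : ∀ i, 0 < (d i).re) (b : Fin m → ℂ) :
    Integrable (fun v : Fin m → ℂ => ∏ l, EE (d l) (b l) (v l)) ∧
    ∫ v : Fin m → ℂ, ∏ l, EE (d l) (b l) (v l) = ∏ l, ZZ (d l) (b l) := by
  constructor
  · exact Integrable.fintype_prod (f := fun l z => EE (d l) (b l) z)
      (fun l => (EE_moments (hd l) (b l)).1.1)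
  · rw [integral_fintype_prod_volume_eq_prod (fun l z => EE (d l) (b l) z)]
    exact Finset.prod_congr rfl fun l _ => (EE_moments (hd l) (b l)).1.2

lemma EP_two {m : ℕ} {d : Fin m → ℂ} (hd : ∀ i, 0 < (d i).re) (b : Fin m → ℂ) (j k : Fin m) :
    Integrable (fun v : Fin m → ℂ => star (v j) * v k * ∏ l, EE (d l) (b l) (v l)) ∧
    ∫ v : Fin m → ℂ, star (v j) * v k * ∏ l, EE (d l) (b l) (v l) =
      ((if j = k then 1 / d j else 0) - star (b j) * b k / (d j * d k)) * ∏ l, ZZ (d l) (b l) := by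
  have hd0 : ∀ i, d i ≠ 0 := fun i h => by have := hd i; simp [h] at this
  let F : Fin m → ℂ → ℂ := fun l z =>
    (if l = j then star z else 1) * (if l = k then z else 1) * EE (d l) (b l) z
  have hF : (fun v : Fin m → ℂ => star (v j) * v k * ∏ l, EE (d l) (b l) (v l)) =
      fun v => ∏ l, F l (v l) := by
    ext v
    simp only [F, Finset.prod_mul_distrib]
    simp
  have hFi : ∀ l, Integrable (F l) := by
    intro l
    obtain ⟨h0, h1, h2, h3⟩ := EE_moments (hd l) (b l)
    by_cases hj : l = j <;> by_cases hk : l = k <;> simp only [F, hj, hk, if_true, if_false, one_mul, mul_one]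
    · subst hj; subst hk; simpa using h3.1
    · subst hj; simpa [hk] using h1.1
    · subst hk; simpa [hj] using h2.1
    · exact h0.1
  have hFv : ∀ l, ∫ z, F l z = (if l = j then (if j = k then 1 / d j - star (b j) * b j / d j ^ 2
      else -Complex.I * star (b j) / d j) else 1) * (if l = k then (if j = k then 1
        else -Complex.I * b k / d k) else 1) * ZZ (d l) (b l) := by
    intro l
    obtain ⟨h0, h1, h2, h3⟩ := EE_moments (hd l) (b l)
    by_cases hj : l = j <;> by_cases hk : l = k
    · subst hj; subst hk; simpa [F] using h3.2
    · subst hj; simpa [F, hk] using h1.2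
    · subst hk; simpa [F, hj, Ne.symm hj] using h2.2
    · simpa [F, hj, hk] using h0.2
  rw [hF]
  refine ⟨Integrable.fintype_prod hFi, ?_⟩
  rw [integral_fintype_prod_volume_eq_prod, Finset.prod_congr rfl fun l _ => hFv l,
    Finset.prod_mul_distrib, Finset.prod_mul_distrib]
  congr 1
  rw [Finset.prod_ite_eq' , Finset.prod_ite_eq']
  by_cases h : j = k
  · subst h; simp; ring
  · simp only [Finset.mem_univ, if_true, h, if_false]
    have := hd0 j
    have := hd0 k
    field_simp
    linear_combination (star (b j) * b k) * Complex.I_sq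

/-- Gaussian integral with linear source and quadratic observable.
For `B ∈ ℂ^{m×m}` with positive definite Hermitian part, `a ∈ ℂ^m` and `c ∈ ℂ`:
`det B · π⁻ᵐ ∫ (‖w‖² + c) e^{-⟨w,Bw⟩ - i⟨w,a⟩ - i⟨a,w⟩} dw
  = e^{-⟨a,B⁻¹a⟩} (Tr B⁻¹ - ⟨a,B⁻²a⟩ + c)`. -/
theorem gaussian_linear_source_quadratic_observable (m : ℕ) (hm : 1 ≤ m)
    (B : Matrix (Fin m) (Fin m) ℂ)
    (hB : ∀ w : Fin m → ℂ, w ≠ 0 → 0 < (star w ⬝ᵥ (B *ᵥ w)).re)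
    (a : Fin m → ℂ) (c : ℂ) :
    B.det * ((Real.pi : ℂ) ^ m)⁻¹ *
        ∫ w : Fin m → ℂ,
          ((∑ j, (‖w j‖ : ℂ) ^ 2) + c) *
            Complex.exp (-(star w ⬝ᵥ (B *ᵥ w)) - Complex.I * (star w ⬝ᵥ a) -
              Complex.I * (star a ⬝ᵥ w)) =
      Complex.exp (-(star a ⬝ᵥ (B⁻¹ *ᵥ a))) *
        (Matrix.trace B⁻¹ - star a ⬝ᵥ ((B⁻¹ * B⁻¹) *ᵥ a) + c) := by
  obtain ⟨Q, d, hQ, hd, hD⟩ := decomp B hB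
  have hd0 : ∀ i, d i ≠ 0 := fun i h => by have := hd i; simp [h] at this
  set b : Fin m → ℂ := Qᴴ *ᵥ a with hb
  obtain ⟨G, hG⟩ : ∃ G : Matrix (Fin m) (Fin m) ℂ, G = Qᴴ * Q := ⟨_, rfl⟩
  have hsb : star b = star a ᵥ* Q := by
    rw [hb, star_mulVec, conjTranspose_conjTranspose]
  have hdet : B.det * (star Q.det * Q.det) = ∏ i, d i := by
    have := congrArg det hD
    rw [det_mul, det_mul, det_conjTranspose, det_diagonal] at this
    rw [← this]; ring
  have hinv : B⁻¹ = Q * diagonal (fun i => (d i)⁻¹) * Qᴴ := by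
    apply Matrix.inv_eq_right_inv
    have hu : IsUnit (Qᴴ).det := by
      rw [det_conjTranspose]; exact isUnit_iff_ne_zero.2 (star_ne_zero.2 hQ)
    have h1 : Qᴴ * (B * (Q * diagonal (fun i => (d i)⁻¹) * Qᴴ)) = Qᴴ * 1 := by
      calc _ = (Qᴴ * B * Q) * diagonal (fun i => (d i)⁻¹) * Qᴴ := by simp only [Matrix.mul_assoc]
        _ = _ := by
          rw [hD, diagonal_mul_diagonal]
          simp [hd0]
    have h2 := congrArg (fun X => (Qᴴ)⁻¹ * X) h1
    simpa only [← Matrix.mul_assoc, Matrix.nonsing_inv_mul _ hu, Matrix.one_mul] using h2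
  have hx1 : star a ⬝ᵥ (B⁻¹ *ᵥ a) = ∑ i, star (b i) * b i / d i := by
    rw [hinv, ← mulVec_mulVec, ← hb, ← mulVec_mulVec, dotProduct_mulVec, ← hsb]
    simp only [dotProduct, mulVec_diagonal, Pi.star_apply]
    exact Finset.sum_congr rfl fun i _ => by ring
  have hx2 : star a ⬝ᵥ ((B⁻¹ * B⁻¹) *ᵥ a) =
      ∑ j, ∑ k, G j k * (star (b j) * b k / (d j * d k)) := by
    have : B⁻¹ * B⁻¹ = Q * (diagonal (fun i => (d i)⁻¹) * (G * (diagonal (fun i => (d i)⁻¹) * Qᴴ))) := by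
      rw [hinv, hG]; simp only [Matrix.mul_assoc]
    rw [this, ← mulVec_mulVec, dotProduct_mulVec, ← hsb, ← mulVec_mulVec, ← mulVec_mulVec,
      ← mulVec_mulVec, ← hb]
    have hmv : ∀ u : Fin m → ℂ, diagonal (fun i => (d i)⁻¹) *ᵥ u = fun i => (d i)⁻¹ * u i :=
      fun u => funext fun i => mulVec_diagonal _ _ _
    rw [hmv, hmv]
    simp only [dotProduct, Pi.star_apply, mulVec, Finset.mul_sum]
    refine Finset.sum_congr rfl fun j _ => Finset.sum_congr rfl fun k _ => ?_
    rw [div_eq_mul_inv, mul_inv]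
    ring
  have hx3 : trace B⁻¹ = ∑ j, ∑ k, G j k * (if j = k then 1 / d j else 0) := by
    rw [hinv, Matrix.mul_assoc, trace_mul_comm, Matrix.mul_assoc, ← hG]
    simp [trace, diagonal_mul, mul_comm]
  have hint : ∀ v : Fin m → ℂ, ((∑ j, (‖(Q *ᵥ v) j‖ : ℂ) ^ 2) + c) *
            Complex.exp (-(star (Q *ᵥ v) ⬝ᵥ (B *ᵥ (Q *ᵥ v))) - Complex.I * (star (Q *ᵥ v) ⬝ᵥ a) -
              Complex.I * (star a ⬝ᵥ (Q *ᵥ v))) =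
      (∑ j, ∑ k, G j k * (star (v j) * v k * ∏ l, EE (d l) (b l) (v l))) +
        c * ∏ l, EE (d l) (b l) (v l) := by
    intro v
    have e1 : (∑ j, (‖(Q *ᵥ v) j‖ : ℂ) ^ 2) = ∑ j, ∑ k, G j k * (star (v j) * v k) := by
      have : (∑ j, (‖(Q *ᵥ v) j‖ : ℂ) ^ 2) = star (Q *ᵥ v) ⬝ᵥ (Q *ᵥ v) := by
        simp only [dotProduct, Pi.star_apply, Complex.star_def, Complex.conj_mul']
      rw [this, star_mulVec, ← dotProduct_mulVec, mulVec_mulVec, ← hG]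
      simp only [dotProduct, mulVec, Pi.star_apply, Finset.mul_sum]
      refine Finset.sum_congr rfl fun j _ => Finset.sum_congr rfl fun k _ => ?_
      ring
    have e2 : star (Q *ᵥ v) ⬝ᵥ (B *ᵥ (Q *ᵥ v)) = ∑ l, d l * (star (v l) * v l) := by
      rw [star_mulVec, ← dotProduct_mulVec, mulVec_mulVec, mulVec_mulVec, hD]
      simp only [dotProduct, mulVec_diagonal, Pi.star_apply]
      exact Finset.sum_congr rfl fun i _ => by ring
    have e3 : star (Q *ᵥ v) ⬝ᵥ a = ∑ l, star (v l) * b l := by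
      rw [star_mulVec, ← dotProduct_mulVec, ← hb]; rfl
    have e4 : star a ⬝ᵥ (Q *ᵥ v) = ∑ l, star (b l) * v l := by
      rw [dotProduct_mulVec, ← hsb]; rfl
    have e5 : Complex.exp (-(star (Q *ᵥ v) ⬝ᵥ (B *ᵥ (Q *ᵥ v))) - Complex.I * (star (Q *ᵥ v) ⬝ᵥ a) -
              Complex.I * (star a ⬝ᵥ (Q *ᵥ v))) = ∏ l, EE (d l) (b l) (v l) := by
      unfold EE
      rw [← Complex.exp_sum, e2, e3, e4, Finset.sum_sub_distrib, Finset.sum_sub_distrib,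
        Finset.sum_neg_distrib, Finset.mul_sum, Finset.mul_sum]
    rw [e5, e1, add_mul, Finset.sum_mul]
    congr 1
    refine Finset.sum_congr rfl fun j _ => ?_
    rw [Finset.sum_mul]
    exact Finset.sum_congr rfl fun k _ => by ring
  have hZ : ∏ l, ZZ (d l) (b l) = (Real.pi : ℂ) ^ m * (∏ l, d l)⁻¹ *
      Complex.exp (-(star a ⬝ᵥ (B⁻¹ *ᵥ a))) := by
    unfold ZZ
    rw [Finset.prod_mul_distrib, ← Complex.exp_sum, hx1, Finset.prod_div_distrib]
    simp [neg_div, div_eq_mul_inv]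
  have hI : ∫ v : Fin m → ℂ, ((∑ j, ∑ k, G j k * (star (v j) * v k * ∏ l, EE (d l) (b l) (v l))) +
        c * ∏ l, EE (d l) (b l) (v l)) =
      (trace B⁻¹ - star a ⬝ᵥ ((B⁻¹ * B⁻¹) *ᵥ a) + c) * ∏ l, ZZ (d l) (b l) := by
    have i1 : ∀ j k, Integrable (fun v : Fin m → ℂ =>
        G j k * (star (v j) * v k * ∏ l, EE (d l) (b l) (v l))) :=
      fun j k => (EP_two hd b j k).1.const_mul _
    rw [integral_add (integrable_finsetSum _ fun j _ => integrable_finsetSum _ fun k _ => i1 j k)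
      ((EP_zero hd b).1.const_mul _), integral_const_mul, (EP_zero hd b).2,
      integral_finsetSum _ (fun j _ => integrable_finsetSum _ fun k _ => i1 j k), hx2, hx3, add_mul,
      ← Finset.sum_sub_distrib, Finset.sum_mul]
    congr 1
    refine Finset.sum_congr rfl fun j _ => ?_
    rw [integral_finsetSum _ (fun k _ => i1 j k), ← Finset.sum_sub_distrib, Finset.sum_mul]
    refine Finset.sum_congr rfl fun k _ => ?_
    rw [integral_const_mul, (EP_two hd b j k).2]
    ring
  rw [cov_s12 Q hQ]
  simp_rw [hint]
  rw [hI, hZ]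
  have hpi : (Real.pi : ℂ) ^ m ≠ 0 := pow_ne_zero _ (by simp [Real.pi_ne_zero])
  have hp : ∏ l, d l ≠ 0 := Finset.prod_ne_zero_iff.2 fun l _ => hd0 l
  generalize (trace B⁻¹ - star a ⬝ᵥ ((B⁻¹ * B⁻¹) *ᵥ a) + c) = T
  generalize Complex.exp (-(star a ⬝ᵥ (B⁻¹ *ᵥ a))) = X
  calc _ = (B.det * (star Q.det * Q.det)) * (∏ l, d l)⁻¹ * (((Real.pi : ℂ) ^ m)⁻¹ * (Real.pi : ℂ) ^ m) * X * T := by ring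
    _ = X * T := by rw [hdet, mul_inv_cancel₀ hp, inv_mul_cancel₀ hpi]; ring
end
end
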